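/- arXiv:2003.01027 — 5 statements merged into one kernel-verified Lean document; each statement's English description precedes it below -/
import Mathlib

section
/- Let β ∈ (0,1]. For every real s > 0, the Laplace transform of the Mittag-Leffler survival function satisfies ∫_0^∞ E_β(-t^β) e^{-st} dt = s^{β-1} / (1 + s^β). -/
open MeasureTheory Set Filter

/-- The two-parameter Mittag-Leffler function `E_{γ,δ}(z) = ∑ zⁿ / Γ(nγ + δ)`. -/
noncomputable def ML2 (γ δ z : ℝ) : ℝ := ∑' n : ℕ, z ^ n / Real.Gamma (n * γ + δ)

/-- The one-parameter Mittag-Leffler function `E_β(z) = E_{β,1}(z)`. -/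
noncomputable def ML (β z : ℝ) : ℝ := ML2 β 1 z

/-- The Mittag-Leffler density `f_β(t) = t^{β-1} E_{β,β}(-t^β)`. -/
noncomputable def fML (β t : ℝ) : ℝ := t ^ (β - 1) * ML2 β β (-(t ^ β))

/-- The spectral kernel `K_β(θ)`. -/
noncomputable def Kspec (β θ : ℝ) : ℝ :=
  (1 / Real.pi) * (θ ^ (β - 1) * Real.sin (β * Real.pi)) /
    (θ ^ (2 * β) + 2 * θ ^ β * Real.cos (β * Real.pi) + 1)


lemma aux_Gamma_lb {x A : ℝ} (hx : 0 ≤ x) (hA : 0 < A) :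
    A ^ x * Real.exp (-A) ≤ Real.Gamma (x + 1) := by
  rw [Real.Gamma_eq_integral (by linarith)]
  have hint := Real.GammaIntegral_convergent (s := x + 1) (by linarith)
  have h1 : A ^ x * Real.exp (-A) = ∫ t in Ioi A, A ^ x * Real.exp (-t) := by
    rw [integral_const_mul, integral_exp_neg_Ioi]
  rw [h1]
  have hsub : Ioi A ⊆ Ioi (0:ℝ) := Ioi_subset_Ioi hA.le
  calc _ ≤ ∫ t in Ioi A, Real.exp (-t) * t ^ (x + 1 - 1) := by
        apply setIntegral_mono_on
        · exact ((integrableOn_exp_neg_Ioi A).const_mul _)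
        · exact hint.mono_set hsub
        · exact measurableSet_Ioi
        · intro t ht
          rw [mul_comm]
          apply mul_le_mul_of_nonneg_left _ (Real.exp_pos _).le
          rw [add_sub_cancel_right]
          exact Real.rpow_le_rpow hA.le (le_of_lt ht) hx
    _ ≤ _ := by
        apply setIntegral_mono_set hint
        · filter_upwards [ae_restrict_mem measurableSet_Ioi] with t ht
          have : (0:ℝ) < t := ht
          simp only [Pi.zero_apply]; positivity
        · exact hsub.eventuallyLE

lemma aux_summable {β : ℝ} (hβ : 0 < β) (z : ℝ) (hz : 0 ≤ z) :
    Summable (fun n : ℕ => z ^ n / Real.Gamma (n * β + 1)) := by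
  set B : ℝ := 2 * z + 1
  have hB : 0 < B := by positivity
  set A : ℝ := B ^ (1 / β)
  have hA : 0 < A := by positivity
  have hAB : A ^ β = B := by
    rw [← Real.rpow_mul hB.le, one_div_mul_cancel hβ.ne', Real.rpow_one]
  have hg : Summable (fun n : ℕ => Real.exp A * (z / B) ^ n) := by
    apply Summable.mul_left
    apply summable_geometric_of_lt_one (by positivity)
    rw [div_lt_one hB]; linarith
  refine Summable.of_nonneg_of_le (fun n => ?_) (fun n => ?_) hg
  · have : 0 < Real.Gamma (n * β + 1) := Real.Gamma_pos_of_pos (by positivity)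
    positivity
  · have h := aux_Gamma_lb (x := n * β) (by positivity) hA
    have h2 : A ^ ((n:ℝ) * β) = B ^ n := by
      rw [mul_comm, Real.rpow_mul hA.le, hAB, Real.rpow_natCast]
    rw [h2] at h
    have h0 : 0 < B ^ n * Real.exp (-A) := by positivity
    calc z ^ n / Real.Gamma (n * β + 1) ≤ z ^ n / (B ^ n * Real.exp (-A)) := by gcongr
      _ = _ := by rw [Real.exp_neg, div_pow]; field_simp

lemma aux_cont_ML {β : ℝ} (hβ : 0 < β) : Continuous (ML β) := by
  rw [continuous_iff_continuousAt]
  intro x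
  have : ContinuousOn (ML β) (Metric.ball 0 (|x| + 1)) := by
    unfold ML ML2
    apply continuousOn_tsum (u := fun n : ℕ => (|x| + 1) ^ n / Real.Gamma (n * β + 1))
    · intro n; fun_prop
    · exact aux_summable hβ _ (by positivity)
    · intro n y hy
      have : 0 < Real.Gamma (n * β + 1) := Real.Gamma_pos_of_pos (by positivity)
      rw [norm_div, norm_pow, Real.norm_of_nonneg this.le]
      have : ‖y‖ ≤ |x| + 1 := (mem_ball_zero_iff.1 hy).le
      gcongr
  exact this.continuousAt (Metric.isOpen_ball.mem_nhds (by simp))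

lemma aux_cont_u {β : ℝ} (hβ : 0 < β) : Continuous (fun t : ℝ => ML β (-(t ^ β))) :=
  (aux_cont_ML hβ).comp (Real.continuous_rpow_const hβ.le).neg

lemma aux_hasSum {β : ℝ} (hβ : 0 < β) (z : ℝ) :
    HasSum (fun n : ℕ => z ^ n / Real.Gamma (n * β + 1)) (ML β z) := by
  apply Summable.hasSum
  apply Summable.of_norm
  convert aux_summable hβ |z| (abs_nonneg z) using 2 with n
  have : 0 < Real.Gamma (n * β + 1) := Real.Gamma_pos_of_pos (by positivity)
  rw [norm_div, norm_pow, Real.norm_of_nonneg this.le, Real.norm_eq_abs]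

lemma aux_beta {a b t : ℝ} (ha : 0 < a) (hb : 0 < b) (ht : 0 < t) :
    ∫ x in (0:ℝ)..t, x ^ (a - 1) * (t - x) ^ (b - 1) =
      t ^ (a + b - 1) * (Real.Gamma a * Real.Gamma b / Real.Gamma (a + b)) := by
  have h := Complex.betaIntegral_scaled a b ht
  rw [Complex.betaIntegral_eq_Gamma_mul_div _ _ (by simpa) (by simpa)] at h
  apply Complex.ofReal_injective
  rw [← intervalIntegral.integral_ofReal]
  push_cast
  rw [Complex.ofReal_cpow ht.le, ← Complex.Gamma_ofReal, ← Complex.Gamma_ofReal,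
    ← Complex.Gamma_ofReal]
  push_cast
  rw [← h]
  apply intervalIntegral.integral_congr
  intro x hx
  rw [uIcc_of_le ht.le] at hx
  simp only []
  rw [Complex.ofReal_cpow hx.1, Complex.ofReal_cpow (by linarith [hx.2])]
  push_cast
  rfl

lemma aux_kint {β : ℝ} (hβ : 0 < β) (t : ℝ) :
    IntervalIntegrable (fun τ : ℝ => (t - τ) ^ (β - 1)) volume 0 t := by
  have h := (intervalIntegral.intervalIntegrable_rpow' (a := 0) (b := t)
    (r := β - 1) (by linarith)).comp_sub_left t
  simpa using h.symm

lemma aux_volterra {β : ℝ} (hβ : 0 < β) {t : ℝ} (ht : 0 < t) :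
    ∫ τ in (0:ℝ)..t, (t - τ) ^ (β - 1) * ML β (-(τ ^ β)) =
      Real.Gamma β * (1 - ML β (-(t ^ β))) := by
  have hΓ : ∀ n : ℕ, 0 < Real.Gamma (n * β + 1) :=
    fun n => Real.Gamma_pos_of_pos (by positivity)
  have h1 : HasSum (fun n : ℕ => ∫ τ in (0:ℝ)..t,
      (t - τ) ^ (β - 1) * ((-(τ ^ β)) ^ n / Real.Gamma (n * β + 1)))
      (∫ τ in (0:ℝ)..t, (t - τ) ^ (β - 1) * ML β (-(τ ^ β))) := by
    apply intervalIntegral.hasSum_integral_of_dominated_convergence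
      (fun (n : ℕ) τ => (t - τ) ^ (β - 1) * ((t ^ β) ^ n / Real.Gamma (n * β + 1)))
    · intro n
      exact (by fun_prop : Measurable _).aestronglyMeasurable
    · intro n
      refine Eventually.of_forall fun τ hτ => ?_
      rw [uIoc_of_le ht.le] at hτ
      have h0 : 0 ≤ t - τ := by linarith [hτ.2]
      have h2 : 0 ≤ τ := hτ.1.le
      have h3 : 0 ≤ τ ^ β := by positivity
      rw [norm_mul, norm_div, norm_pow, norm_neg, Real.norm_of_nonneg (hΓ n).le,
        Real.norm_of_nonneg h3, Real.norm_of_nonneg (Real.rpow_nonneg h0 _)]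
      have := hΓ n
      have := hτ.2
      gcongr
    · refine Eventually.of_forall fun τ hτ => ?_
      exact (aux_summable hβ _ (by positivity)).mul_left _
    · simp_rw [tsum_mul_left]
      exact (aux_kint hβ t).mul_const _
    · refine Eventually.of_forall fun τ hτ => ?_
      exact (aux_hasSum hβ _).mul_left _
  have h2 : HasSum (fun n : ℕ => ∫ τ in (0:ℝ)..t,
      (t - τ) ^ (β - 1) * ((-(τ ^ β)) ^ n / Real.Gamma (n * β + 1)))
      (Real.Gamma β * (1 - ML β (-(t ^ β)))) := by
    have h3 := aux_hasSum hβ (-(t ^ β))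
    rw [← hasSum_nat_add_iff' 1] at h3
    have h4 := h3.mul_left (-Real.Gamma β)
    have h5 : -Real.Gamma β * (ML β (-(t ^ β)) - ∑ i ∈ Finset.range 1,
        (-(t ^ β)) ^ i / Real.Gamma (i * β + 1)) = Real.Gamma β * (1 - ML β (-(t ^ β))) := by
      simp
      ring
    rw [h5] at h4
    refine (congrArg (fun f : ℕ → ℝ => HasSum f (Real.Gamma β * (1 - ML β (-(t ^ β)))))
      (funext ?_)).mpr h4
    · intro n
      have e : ∀ τ ∈ uIcc 0 t, (t - τ) ^ (β - 1) * ((-(τ ^ β)) ^ n / Real.Gamma (n * β + 1))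
          = ((-1) ^ n / Real.Gamma (n * β + 1)) *
            (τ ^ ((n * β + 1) - 1) * (t - τ) ^ (β - 1)) := by
        intro τ hτ
        rw [uIcc_of_le ht.le] at hτ
        rw [neg_pow, ← Real.rpow_natCast (τ ^ β), ← Real.rpow_mul hτ.1]
        rw [add_sub_cancel_right, mul_comm β]
        ring
      rw [intervalIntegral.integral_congr e, intervalIntegral.integral_const_mul,
        aux_beta (by positivity) hβ ht]
      have e2 : (n:ℝ) * β + 1 + β = ((n + 1 : ℕ) : ℝ) * β + 1 := by push_cast; ring
      have e3 : (n:ℝ) * β + 1 + β - 1 = β * ((n + 1 : ℕ) : ℝ) := by push_cast; ring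
      rw [e3, e2, Real.rpow_mul ht.le, Real.rpow_natCast, neg_pow (t ^ β)]
      have := (hΓ n).ne'
      have := (hΓ (n+1)).ne'
      field_simp
      ring
  exact h1.unique h2

lemma aux_w_cont {u : ℝ → ℝ} (hu : Continuous u) :
    Continuous (fun p : ℝ × ℝ => ∫ τ in (0:ℝ)..p.1, Real.exp (-((p.1 - τ) * p.2)) * u τ) := by
  apply intervalIntegral.continuous_parametric_intervalIntegral_of_continuous _ continuous_fst
  simp only [Function.uncurry_def]
  fun_prop

lemma aux_energy_r {u : ℝ → ℝ} (hu : Continuous u) {r s T : ℝ} (hr : 0 ≤ r) (hs : 0 ≤ s)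
    (hT : 0 ≤ T) :
    0 ≤ ∫ t in (0:ℝ)..T, Real.exp (-(s * t)) * u t *
      ∫ τ in (0:ℝ)..t, Real.exp (-((t - τ) * r)) * u τ := by
  set w : ℝ → ℝ := fun t => ∫ τ in (0:ℝ)..t, Real.exp (-((t - τ) * r)) * u τ with hw
  have hwc : Continuous w := by
    have := (aux_w_cont hu).comp (by fun_prop : Continuous (fun t : ℝ => (t, r)))
    exact this
  have hw2 : w = fun t => Real.exp (-(r * t)) * ∫ τ in (0:ℝ)..t, Real.exp (r * τ) * u τ := by
    ext t
    simp only [hw]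
    rw [← intervalIntegral.integral_const_mul]
    congr 1; ext τ
    rw [← mul_assoc, ← Real.exp_add]; congr 2; ring
  have hd : ∀ t, HasDerivAt w (u t - r * w t) t := by
    intro t
    have h1 : HasDerivAt (fun t => ∫ τ in (0:ℝ)..t, Real.exp (r * τ) * u τ)
        (Real.exp (r * t) * u t) t := by
      have hc : Continuous (fun τ => Real.exp (r * τ) * u τ) := by fun_prop
      exact hc.integral_hasStrictDerivAt 0 t |>.hasDerivAt
    have h2 : HasDerivAt (fun t => Real.exp (-(r * t))) (Real.exp (-(r * t)) * (-(r * 1))) t :=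
      (((hasDerivAt_id t).const_mul r).neg).exp
    have h3 := h2.mul h1
    rw [hw2]
    refine h3.congr_deriv ?_
    have : Real.exp (-(r * t)) * Real.exp (r * t) = 1 := by rw [← Real.exp_add]; simp
    linear_combination (u t) * this
  have hφ : ∀ t ∈ uIcc 0 T, HasDerivAt (fun t => Real.exp (-(s * t)) * (w t) ^ 2 / 2)
      (Real.exp (-(s * t)) * (w t * (u t - r * w t) - s * (w t) ^ 2 / 2)) t := by
    intro t _
    have h2 : HasDerivAt (fun t => Real.exp (-(s * t))) (Real.exp (-(s * t)) * (-(s * 1))) t :=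
      (((hasDerivAt_id t).const_mul s).neg).exp
    refine ((h2.mul ((hd t).pow 2)).div_const 2).congr_deriv ?_
    simp only [Pi.pow_apply]
    push_cast
    ring
  have hint := intervalIntegral.integral_eq_sub_of_hasDerivAt hφ
    (Continuous.intervalIntegrable (by fun_prop) _ _)
  have hw0 : w 0 = 0 := by simp [hw]
  have hge : 0 ≤ ∫ t in (0:ℝ)..T,
      Real.exp (-(s * t)) * (w t * (u t - r * w t) - s * (w t) ^ 2 / 2) := by
    rw [hint, hw0]
    have : 0 ≤ Real.exp (-(s * T)) * (w T) ^ 2 / 2 := by positivity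
    simpa using this
  refine hge.trans (intervalIntegral.integral_mono_on hT
    (Continuous.intervalIntegrable (by fun_prop) _ _)
    (Continuous.intervalIntegrable (by fun_prop) _ _) ?_)
  intro t _
  have : 0 ≤ Real.exp (-(s * t)) * ((r + s / 2) * (w t) ^ 2) := by positivity
  change _ ≤ Real.exp (-(s * t)) * u t * w t
  nlinarith

lemma aux_repr {u : ℝ → ℝ} (hu : Continuous u) {β : ℝ} (hβ : 0 < β) (hβ1 : β < 1) {t : ℝ}
    (ht : 0 < t) :
    Real.Gamma (1 - β) * ∫ τ in (0:ℝ)..t, (t - τ) ^ (β - 1) * u τ =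
      ∫ r in Ioi (0:ℝ), r ^ (1 - β - 1) *
        ∫ τ in (0:ℝ)..t, Real.exp (-((t - τ) * r)) * u τ := by
  have hg : ∀ x : ℝ, 0 < x → ∫ r in Ioi (0:ℝ), r ^ (1 - β - 1) * Real.exp (-(x * r)) =
      x ^ (β - 1) * Real.Gamma (1 - β) := by
    intro x hx
    rw [Real.integral_rpow_mul_exp_neg_mul_Ioi (by linarith) hx, one_div,
      Real.inv_rpow hx.le, ← Real.rpow_neg hx.le]
    congr 2; ring
  have hgi : ∀ x : ℝ, 0 < x →
      IntegrableOn (fun r : ℝ => r ^ (1 - β - 1) * Real.exp (-(x * r))) (Ioi 0) := by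
    intro x hx
    have := integrableOn_rpow_mul_exp_neg_mul_rpow (p := 1) (s := 1 - β - 1) (b := x)
      (by linarith) one_pos hx
    simpa using this
  have hae : ∀ᵐ τ ∂(volume.restrict (uIoc 0 t)), 0 < t - τ := by
    rw [uIoc_of_le ht.le, ← restrict_Ioo_eq_restrict_Ioc]
    filter_upwards [ae_restrict_mem measurableSet_Ioo] with τ hτ
    linarith [hτ.2]
  have hki := (aux_kint hβ t)
  have hku : IntervalIntegrable (fun τ => (t - τ) ^ (β - 1) * u τ) volume 0 t :=
    hki.mul_continuousOn hu.continuousOn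
  have hI : Integrable (Function.uncurry (fun (τ r : ℝ) =>
      (r ^ (1 - β - 1) * Real.exp (-((t - τ) * r))) * u τ))
      ((volume.restrict (uIoc 0 t)).prod (volume.restrict (Ioi 0))) := by
    rw [integrable_prod_iff]
    · constructor
      · filter_upwards [hae] with τ hτ
        exact (hgi _ hτ).mul_const (u τ)
      · have h1 : Integrable (fun τ => ‖(t - τ) ^ (β - 1) * u τ‖ * Real.Gamma (1 - β))
            (volume.restrict (uIoc 0 t)) := by
          exact (intervalIntegrable_iff.1 hku).norm.mul_const _
        refine h1.congr ?_
        filter_upwards [hae] with τ hτ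
        simp only [Function.uncurry_apply_pair, norm_mul]
        rw [integral_mul_const]
        have : ∫ r in Ioi (0:ℝ), ‖r ^ (1 - β - 1)‖ * ‖Real.exp (-((t - τ) * r))‖ =
            ∫ r in Ioi (0:ℝ), r ^ (1 - β - 1) * Real.exp (-((t - τ) * r)) := by
          apply setIntegral_congr_fun measurableSet_Ioi
          intro r hr
          have : 0 < r := hr
          simp only []
          rw [Real.norm_of_nonneg (by positivity), Real.norm_of_nonneg (by positivity)]
        rw [this, hg _ hτ, Real.norm_of_nonneg (by positivity)]
        ring
    · have := hu.measurable
      exact (by fun_prop : Measurable _).aestronglyMeasurable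
  have hsw := intervalIntegral_integral_swap hI
  rw [← intervalIntegral.integral_const_mul]
  calc _ = ∫ τ in (0:ℝ)..t, ∫ r in Ioi (0:ℝ),
        (r ^ (1 - β - 1) * Real.exp (-((t - τ) * r))) * u τ := by
        apply intervalIntegral.integral_congr_ae_restrict
        filter_upwards [hae] with τ hτ
        rw [integral_mul_const, hg _ hτ]; ring
    _ = _ := by
        rw [hsw]
        congr 1; ext r
        rw [← intervalIntegral.integral_const_mul]
        congr 1; ext τ; ring

lemma aux_w_bound {u : ℝ → ℝ} {M t T r : ℝ} (hM : ∀ τ ∈ Icc 0 T, |u τ| ≤ M)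
    (h0M : 0 ≤ M) (ht : 0 ≤ t) (htT : t ≤ T) (hr : 0 < r) :
    |∫ τ in (0:ℝ)..t, Real.exp (-((t - τ) * r)) * u τ| ≤ M * min T (1 / r) := by
  rw [mul_min_of_nonneg _ _ h0M, le_min_iff]
  constructor
  · have := intervalIntegral.norm_integral_le_of_norm_le_const (a := 0) (b := t) (C := M)
      (f := fun τ => Real.exp (-((t - τ) * r)) * u τ) (by
        intro τ hτ
        rw [uIoc_of_le ht] at hτ
        rw [norm_mul, Real.norm_of_nonneg (Real.exp_pos _).le]
        have h1 : Real.exp (-((t - τ) * r)) ≤ 1 := by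
          rw [Real.exp_le_one_iff]
          have : 0 ≤ t - τ := by linarith [hτ.2]
          have := mul_nonneg this hr.le
          linarith
        have h2 := hM τ ⟨hτ.1.le, hτ.2.trans htT⟩
        calc _ ≤ 1 * M := by gcongr; exact h2
          _ = M := one_mul M)
    rw [sub_zero, abs_of_nonneg ht] at this
    exact this.trans (by gcongr)
  · have hd : ∀ τ ∈ uIcc 0 t, HasDerivAt (fun τ => M * (Real.exp (-((t - τ) * r)) / r))
        (Real.exp (-((t - τ) * r)) * M) τ := by
      intro τ _
      have := (((((hasDerivAt_id τ).const_sub t).mul_const r).neg.exp).div_const r).const_mul M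
      refine this.congr_deriv ?_
      simp only [Pi.neg_apply, id]
      field_simp
    have hii : IntervalIntegrable (fun τ => Real.exp (-((t - τ) * r)) * M) volume 0 t :=
      Continuous.intervalIntegrable (by fun_prop) _ _
    have h1 := intervalIntegral.norm_integral_le_of_norm_le (a := 0) (b := t) (μ := volume)
      (f := fun τ => Real.exp (-((t - τ) * r)) * u τ)
      (g := fun τ => Real.exp (-((t - τ) * r)) * M) ht (by
        refine Eventually.of_forall fun τ hτ => ?_
        rw [norm_mul, Real.norm_of_nonneg (Real.exp_pos _).le]
        gcongr
        exact hM τ ⟨hτ.1.le, hτ.2.trans htT⟩) hii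
    rw [intervalIntegral.integral_eq_sub_of_hasDerivAt hd hii] at h1
    refine h1.trans ?_
    have : 0 ≤ M * (Real.exp (-((t - 0) * r)) / r) := by positivity
    simp only [sub_self, zero_mul, neg_zero, Real.exp_zero]
    linarith

lemma aux_g_int {β T : ℝ} (hβ : 0 < β) (hβ1 : β < 1) (hT : 0 ≤ T) :
    IntegrableOn (fun r : ℝ => r ^ (1 - β - 1) * min T (1 / r)) (Ioi 0) := by
  have hm : Measurable (fun r : ℝ => r ^ (1 - β - 1) * min T (1 / r)) := by fun_prop
  rw [← Ioc_union_Ioi_eq_Ioi (zero_le_one : (0:ℝ) ≤ 1)]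
  apply IntegrableOn.union
  · have h1 : IntegrableOn (fun r : ℝ => r ^ (1 - β - 1) * T) (Ioc 0 1) := by
      have := (intervalIntegral.intervalIntegrable_rpow' (a := 0) (b := 1)
        (r := 1 - β - 1) (by linarith)).mul_const T
      rwa [intervalIntegrable_iff_integrableOn_Ioc_of_le zero_le_one] at this
    refine h1.mono' hm.aestronglyMeasurable ?_
    filter_upwards [ae_restrict_mem measurableSet_Ioc] with r hr
    have hr0 : 0 < r := hr.1
    rw [Real.norm_of_nonneg (by positivity)]
    gcongr
    exact min_le_left _ _
  · have h1 : IntegrableOn (fun r : ℝ => r ^ (-β - 1)) (Ioi 1) :=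
      integrableOn_Ioi_rpow_of_lt (by linarith) one_pos
    refine h1.mono' hm.aestronglyMeasurable ?_
    filter_upwards [ae_restrict_mem measurableSet_Ioi] with r hr
    have hr0 : 0 < r := lt_trans one_pos hr
    rw [Real.norm_of_nonneg (by positivity)]
    have : r ^ (-β - 1) = r ^ (1 - β - 1) * (1 / r) := by
      rw [Real.rpow_sub_one hr0.ne', div_eq_mul_one_div]; congr 2; ring
    rw [this]
    gcongr
    exact min_le_right _ _

lemma aux_energy_k {u : ℝ → ℝ} (hu : Continuous u) {β s T : ℝ} (hβ : 0 < β) (hβ1 : β < 1)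
    (hs : 0 ≤ s) (hT : 0 ≤ T) :
    0 ≤ ∫ t in (0:ℝ)..T, Real.exp (-(s * t)) * u t *
      ∫ τ in (0:ℝ)..t, (t - τ) ^ (β - 1) * u τ := by
  have hΓ : 0 < Real.Gamma (1 - β) := Real.Gamma_pos_of_pos (by linarith)
  rw [← mul_nonneg_iff_of_pos_left hΓ, ← intervalIntegral.integral_const_mul]
  have hI : Integrable (Function.uncurry (fun (t r : ℝ) => r ^ (1 - β - 1) *
      (Real.exp (-(s * t)) * u t * ∫ τ in (0:ℝ)..t, Real.exp (-((t - τ) * r)) * u τ)))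
      ((volume.restrict (uIoc 0 T)).prod (volume.restrict (Ioi 0))) := by
    obtain ⟨M, hM⟩ := isCompact_Icc.exists_bound_of_continuousOn (s := Icc 0 T) hu.continuousOn
    have h0M : 0 ≤ M := (norm_nonneg _).trans (hM 0 ⟨le_rfl, hT⟩)
    have h1 : Integrable (fun t : ℝ => M * M) (volume.restrict (uIoc 0 T)) := by
      rw [uIoc_of_le hT]; exact integrable_const _
    have h2 := h1.mul_prod (aux_g_int hβ hβ1 hT)
    refine h2.mono' ?_ ?_
    · have hm := (aux_w_cont hu).measurable
      have := hu.measurable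
      simp only [Function.uncurry_def]
      refine Measurable.aestronglyMeasurable ?_
      refine Measurable.mul (by fun_prop) (Measurable.mul (by fun_prop) hm)
    · rw [Measure.prod_restrict]
      filter_upwards [ae_restrict_mem (measurableSet_uIoc.prod measurableSet_Ioi)] with p hp
      obtain ⟨hp1, hp2⟩ := hp
      rw [uIoc_of_le hT] at hp1
      have hr : 0 < p.2 := hp2
      simp only [Function.uncurry_def]
      have hw := aux_w_bound (u := u) (M := M) hM h0M hp1.1.le hp1.2 hr
      have hub := hM p.1 ⟨hp1.1.le, hp1.2⟩
      have he : Real.exp (-(s * p.1)) ≤ 1 := by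
        rw [Real.exp_le_one_iff]
        have := mul_nonneg hs hp1.1.le
        linarith
      rw [norm_mul, norm_mul, norm_mul, Real.norm_of_nonneg (Real.exp_pos _).le,
        Real.norm_of_nonneg (Real.rpow_nonneg hr.le _)]
      rw [← Real.norm_eq_abs] at hw
      calc _ ≤ p.2 ^ (1 - β - 1) * (1 * M * (M * min T (1 / p.2))) := by gcongr
        _ = _ := by ring
  have hsw := intervalIntegral_integral_swap hI
  have : ∫ t in (0:ℝ)..T, Real.Gamma (1 - β) * (Real.exp (-(s * t)) * u t *
      ∫ τ in (0:ℝ)..t, (t - τ) ^ (β - 1) * u τ) =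
      ∫ t in (0:ℝ)..T, ∫ r in Ioi (0:ℝ), r ^ (1 - β - 1) *
      (Real.exp (-(s * t)) * u t * ∫ τ in (0:ℝ)..t, Real.exp (-((t - τ) * r)) * u τ) := by
    apply intervalIntegral.integral_congr_ae
    refine Eventually.of_forall fun t ht => ?_
    rw [uIoc_of_le hT] at ht
    calc _ = Real.exp (-(s * t)) * u t * (Real.Gamma (1 - β) *
          ∫ τ in (0:ℝ)..t, (t - τ) ^ (β - 1) * u τ) := by ring
      _ = _ := by
        rw [aux_repr hu hβ hβ1 ht.1, ← integral_const_mul]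
        congr 1; ext r; ring
  rw [this, hsw]
  apply setIntegral_nonneg measurableSet_Ioi
  intro r hr
  have hr0 : 0 < r := hr
  rw [intervalIntegral.integral_const_mul]
  exact mul_nonneg (by positivity) (aux_energy_r hu hr0.le hs hT)

lemma aux_int_lt {β : ℝ} (hβ : 0 < β) (hβ1 : β < 1) {s : ℝ} (hs : 0 < s) :
    IntegrableOn (fun t => Real.exp (-(s * t)) * ML β (-(t ^ β))) (Ioi 0) := by
  have hu := aux_cont_u hβ
  set u : ℝ → ℝ := fun t => ML β (-(t ^ β)) with hudef
  have hEi : IntegrableOn (fun t => Real.exp (-(s * t))) (Ioi 0) := by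
    simpa using exp_neg_integrableOn_Ioi 0 hs
  refine integrableOn_Ioi_of_intervalIntegral_norm_bounded (l := atTop) (b := fun T : ℝ => T)
    (∫ t in Ioi (0:ℝ), Real.exp (-(s * t))) 0 (fun T => ?_) tendsto_id ?_
  · have hc : Continuous (fun t => Real.exp (-(s * t)) * u t) := by fun_prop
    exact hc.integrableOn_Icc.mono_set Ioc_subset_Icc_self
  filter_upwards [eventually_ge_atTop 0] with T hT
  have hk := aux_energy_k hu hβ hβ1 hs.le hT
  have hk2 : 0 ≤ ∫ t in (0:ℝ)..T, Real.exp (-(s * t)) * u t * (1 - u t) := by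
    have hΓ : 0 < Real.Gamma β := Real.Gamma_pos_of_pos hβ
    rw [← mul_nonneg_iff_of_pos_left hΓ, ← intervalIntegral.integral_const_mul]
    refine hk.trans_eq ?_
    apply intervalIntegral.integral_congr_ae
    refine Eventually.of_forall fun t ht => ?_
    rw [uIoc_of_le hT] at ht
    simp only [hudef]
    rw [aux_volterra hβ ht.1]
    ring
  have h1 : ∫ t in (0:ℝ)..T, Real.exp (-(s * t)) ≤ ∫ t in Ioi (0:ℝ), Real.exp (-(s * t)) := by
    rw [intervalIntegral.integral_of_le hT]
    exact setIntegral_mono_set hEi (Eventually.of_forall fun t => (Real.exp_pos _).le)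
      Ioc_subset_Ioi_self.eventuallyLE
  have h2 : ∫ t in (0:ℝ)..T, (‖Real.exp (-(s * t)) * u t‖ + Real.exp (-(s * t)) * u t * (1 - u t))
      ≤ ∫ t in (0:ℝ)..T, Real.exp (-(s * t)) := by
    apply intervalIntegral.integral_mono_on hT
    · exact Continuous.intervalIntegrable (by fun_prop) _ _
    · exact Continuous.intervalIntegrable (by fun_prop) _ _
    · intro t _
      rw [norm_mul, Real.norm_of_nonneg (Real.exp_pos _).le, Real.norm_eq_abs]
      have hE := Real.exp_pos (-(s * t))
      have : |u t| + u t * (1 - u t) ≤ 1 := by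
        rcases abs_cases (u t) with ⟨h, _⟩ | ⟨h, _⟩ <;> rw [h] <;> nlinarith [sq_nonneg (u t - 1)]
      nlinarith
  rw [intervalIntegral.integral_add (Continuous.intervalIntegrable (by fun_prop) _ _)
    (Continuous.intervalIntegrable (by fun_prop) _ _)] at h2
  linarith

lemma aux_int_one {s : ℝ} (hs : 0 < s) :
    IntegrableOn (fun t => Real.exp (-(s * t)) * ML 1 (-(t ^ (1:ℝ)))) (Ioi 0) := by
  have h : ∀ z, ML 1 z = Real.exp z := by
    intro z
    rw [Real.exp_eq_exp_ℝ, NormedSpace.exp_eq_tsum_div]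
    unfold ML ML2
    congr 1; ext n
    rw [mul_one, Real.Gamma_nat_eq_factorial]
  simp_rw [h, Real.rpow_one, ← Real.exp_add]
  have := exp_neg_integrableOn_Ioi 0 (by linarith : 0 < s + 1)
  refine this.congr_fun (fun t _ => ?_) measurableSet_Ioi
  simp only []
  congr 1; ring

/-- Laplace transform of the Mittag-Leffler survival function:
`∫_0^∞ E_β(-t^β) e^{-st} dt = s^{β-1}/(1+s^β)` for `β ∈ (0,1]`, `s > 0`. -/
theorem laplace_mittagLeffler_survival (β : ℝ) (hβ : β ∈ Set.Ioc (0:ℝ) 1)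
    (s : ℝ) (hs : 0 < s) :
    ∫ t in Set.Ioi (0:ℝ), ML β (-(t ^ β)) * Real.exp (-(s * t)) =
      s ^ (β - 1) / (1 + s ^ β) := by
  obtain ⟨hβ0, hβ1⟩ := hβ
  have hI : IntegrableOn (fun t => Real.exp (-(s * t)) * ML β (-(t ^ β))) (Ioi 0) := by
    rcases hβ1.lt_or_eq with h | h
    · exact aux_int_lt hβ0 h hs
    · subst h; exact aux_int_one hs
  have hg : IntegrableOn (fun r : ℝ => r ^ (β - 1) * Real.exp (-(s * r))) (Ioi 0) := by
    have := integrableOn_rpow_mul_exp_neg_mul_rpow (p := 1) (s := β - 1) (b := s)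
      (by linarith) one_pos hs
    simpa using this
  have hEi : IntegrableOn (fun t => Real.exp (-(s * t))) (Ioi 0) := by
    simpa using exp_neg_integrableOn_Ioi 0 hs
  have hE : ∫ t in Ioi (0:ℝ), Real.exp (-(s * t)) = 1 / s := by
    have := integral_exp_mul_Ioi (a := -s) (by linarith) 0
    simpa using this
  have hΓ : 0 < Real.Gamma β := Real.Gamma_pos_of_pos hβ0
  have hc := integral_posConvolution hI hg (ContinuousLinearMap.mul ℝ ℝ)
  simp only [ContinuousLinearMap.mul_apply'] at hc
  rw [Real.integral_rpow_mul_exp_neg_mul_Ioi hβ0 hs] at hc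
  have hl : ∫ x in Ioi (0:ℝ), ∫ t in (0:ℝ)..x, (Real.exp (-(s * t)) * ML β (-(t ^ β))) *
      ((x - t) ^ (β - 1) * Real.exp (-(s * (x - t)))) =
      ∫ x in Ioi (0:ℝ), Real.Gamma β * (Real.exp (-(s * x)) -
        Real.exp (-(s * x)) * ML β (-(x ^ β))) := by
    apply setIntegral_congr_fun measurableSet_Ioi
    intro x hx
    have hx0 : 0 < x := hx
    simp only []
    have := aux_volterra hβ0 hx0
    calc _ = ∫ t in (0:ℝ)..x, Real.exp (-(s * x)) * ((x - t) ^ (β - 1) * ML β (-(t ^ β))) := by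
          congr 1; ext t
          have : Real.exp (-(s * x)) = Real.exp (-(s * t)) * Real.exp (-(s * (x - t))) := by
            rw [← Real.exp_add]; congr 1; ring
          rw [this]; ring
      _ = _ := by rw [intervalIntegral.integral_const_mul, this]; ring
  rw [hl, integral_const_mul, integral_sub hEi hI, hE] at hc
  simp_rw [mul_comm (ML β _) (Real.exp _)]
  set F := ∫ t in Ioi (0:ℝ), Real.exp (-(s * t)) * ML β (-(t ^ β))
  have hsb : 0 < s ^ β := by positivity
  rw [one_div s, Real.inv_rpow hs.le] at hc
  rw [Real.rpow_sub_one hs.ne', eq_div_iff (by positivity)]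
  have h3 : s⁻¹ - F = F * (s ^ β)⁻¹ := by
    apply mul_left_cancel₀ hΓ.ne'
    linarith
  field_simp at h3 ⊢
  linarith
end

section
/- Let β ∈ (0,1]. For every real s > 0, the Laplace transform of the Mittag-Leffler density satisfies ∫_0^∞ f_β(t) e^{-st} dt = 1 / (1 + s^β), where f_β(t) = t^{β-1} E_{β,β}(-t^β). -/
open MeasureTheory Set Filter

/-- Complete monotonicity up to order `n` on `(0,∞)`. -/
def CMn : ℕ → (ℝ → ℝ) → Prop
  | 0, g => ∀ s, 0 < s → 0 ≤ g s
  | n + 1, g => (∀ s, 0 < s → 0 ≤ g s) ∧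
      ∃ g' : ℝ → ℝ, (∀ s, 0 < s → HasDerivAt g (-g' s) s) ∧ CMn n g'

lemma CMn.nonneg {n : ℕ} {g : ℝ → ℝ} (h : CMn n g) : ∀ s, 0 < s → 0 ≤ g s := by
  cases n with
  | zero => exact h
  | succ n => exact h.1

lemma CMn.pred {n : ℕ} : ∀ {g : ℝ → ℝ}, CMn (n + 1) g → CMn n g := by
  induction n with
  | zero => intro g h; exact h.1
  | succ n ih =>
    intro g h
    obtain ⟨h1, g', h2, h3⟩ := h
    exact ⟨h1, g', h2, ih h3⟩

lemma CMn.add {n : ℕ} : ∀ {g h : ℝ → ℝ}, CMn n g → CMn n h → CMn n (fun s => g s + h s) := by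
  induction n with
  | zero => intro g h hg hh s hs; exact add_nonneg (hg s hs) (hh s hs)
  | succ n ih =>
    intro g h hg hh
    obtain ⟨h1, g', h2, h3⟩ := hg
    obtain ⟨k1, k', k2, k3⟩ := hh
    refine ⟨fun s hs => add_nonneg (h1 s hs) (k1 s hs), fun s => g' s + k' s, fun s hs => ?_,
      ih h3 k3⟩
    exact ((h2 s hs).add (k2 s hs)).congr_deriv (by ring)

lemma CMn.mul {n : ℕ} : ∀ {g h : ℝ → ℝ}, CMn n g → CMn n h → CMn n (fun s => g s * h s) := by
  induction n with
  | zero => intro g h hg hh s hs; exact mul_nonneg (hg s hs) (hh s hs)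
  | succ n ih =>
    intro g h hg hh
    have hg0 := hg.pred
    have hh0 := hh.pred
    obtain ⟨h1, g', h2, h3⟩ := hg
    obtain ⟨k1, k', k2, k3⟩ := hh
    refine ⟨fun s hs => mul_nonneg (h1 s hs) (k1 s hs), fun s => g' s * h s + g s * k' s,
      fun s hs => ?_, (ih h3 hh0).add (ih hg0 k3)⟩
    exact ((h2 s hs).mul (k2 s hs)).congr_deriv (by ring)

lemma CMn.rpow {n : ℕ} : ∀ {c p : ℝ}, 0 ≤ c → p ≤ 0 → CMn n (fun s => c * s ^ p) := by
  induction n with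
  | zero => intro c p hc hp s hs; positivity
  | succ n ih =>
    intro c p hc hp
    refine ⟨fun s hs => by positivity, fun s => (c * (-p)) * s ^ (p - 1), fun s hs => ?_,
      ih (mul_nonneg hc (by linarith)) (by linarith)⟩
    exact ((Real.hasDerivAt_rpow_const (p := p) (Or.inl hs.ne')).const_mul c).congr_deriv (by ring)

lemma CMn.main {n : ℕ} {β : ℝ} (h0 : 0 < β) (h1 : β ≤ 1) : CMn n (fun s => 1 / (1 + s ^ β)) := by
  induction n with
  | zero => intro s hs; positivity
  | succ n ih =>
    refine ⟨fun s hs => by positivity,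
      fun s => (β * s ^ (β - 1)) * ((1 / (1 + s ^ β)) * (1 / (1 + s ^ β))), fun s hs => ?_,
      (CMn.rpow h0.le (by linarith)).mul (ih.mul ih)⟩
    have hp : 0 < 1 + s ^ β := by positivity
    have := ((Real.hasDerivAt_rpow_const (p := β) (Or.inl hs.ne')).const_add 1).inv hp.ne'
    simp only [one_div]
    exact this.congr_deriv (by field_simp)

/-- transfer of signs to a sequence of successive derivatives on `(1,∞)` -/
lemma CMn.transfer {H : ℕ → ℝ → ℝ}
    (hH : ∀ n s, 1 < s → HasDerivAt (H n) (-(H (n + 1) s)) s) :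
    ∀ (n m : ℕ) (g : ℝ → ℝ), CMn n g → (∀ s, 1 < s → g s = H m s) →
      ∀ s, 1 < s → 0 ≤ H (m + n) s := by
  intro n
  induction n with
  | zero => intro m g hg he s hs; rw [add_zero, ← he s hs]; exact hg s (by linarith)
  | succ n ih =>
    intro m g hg he s hs
    obtain ⟨h1, g', h2, h3⟩ := hg
    have := ih (m + 1) g' h3 (fun u hu => ?_) s hs
    · rwa [show m + (n + 1) = m + 1 + n by ring]
    · have e : g =ᶠ[nhds u] H m := by
        filter_upwards [Ioi_mem_nhds hu] with v hv using he v hv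
      have := ((hH m u hu).congr_of_eventuallyEq e).unique (h2 u (by linarith))
      linarith

lemma c_le {u v : ℝ} (hu : 0 < u) (hv : 0 < v) (h : (1 ≤ v ∧ v ≤ u) ∨ (v ≤ 1 ∧ u ≤ v)) :
    u * Real.exp (1 - u) ≤ v * Real.exp (1 - v) := by
  have h1 : u / v ≤ Real.exp (u / v - 1) := by
    have := Real.add_one_le_exp (u / v - 1); linarith
  have h2 : u ≤ v * Real.exp (u / v - 1) := by
    rw [div_le_iff₀ hv] at h1; linarith
  calc u * Real.exp (1 - u) ≤ v * Real.exp (u / v - 1) * Real.exp (1 - u) := by gcongr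
    _ = v * Real.exp (u / v - u) := by rw [mul_assoc, ← Real.exp_add]; ring_nf
    _ ≤ v * Real.exp (1 - v) := by
      refine mul_le_mul_of_nonneg_left (Real.exp_le_exp.2 ?_) hv.le
      rw [show u / v - u = u * (1 - v) / v by field_simp, div_le_iff₀ hv]
      rcases h with h | h <;> nlinarith

lemma c_lt {v : ℝ} (hv : v ≠ 1) : v * Real.exp (1 - v) < 1 := by
  have := Real.add_one_lt_exp (x := v - 1) (by intro h; apply hv; linarith)
  have h2 : Real.exp (v - 1) * Real.exp (1 - v) = 1 := by
    rw [← Real.exp_add]; simp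
  have := mul_lt_mul_of_pos_right this (Real.exp_pos (1 - v))
  rw [h2] at this
  linarith

lemma peak_nonneg {g : ℝ → ℝ} {t₀ : ℝ} (ht : 0 < t₀) (hg : IntegrableOn g (Ioi 0))
    (hc : ContinuousAt g t₀)
    (h : ∀ n : ℕ, 0 ≤ ∫ t in Ioi (0:ℝ), ((t / t₀) * Real.exp (1 - t / t₀)) ^ n * g t) :
    0 ≤ g t₀ := by
  by_contra! hneg
  set c : ℝ → ℝ := fun t => (t / t₀) * Real.exp (1 - t / t₀) with hcdef
  have hcc : Continuous c := by fun_prop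
  have hc0 : c t₀ = 1 := by simp [hcdef, ht.ne']
  set η := -(g t₀) / 2 with hη
  have hηpos : 0 < η := by linarith
  have ev : ∀ᶠ t in nhds t₀, g t < -η := hc.eventually_lt_const (by linarith)
  obtain ⟨δ', hδ', hb'⟩ := Metric.eventually_nhds_iff.1 ev
  obtain ⟨δ, hδ, hδ2, hδ3⟩ : ∃ δ, 0 < δ ∧ δ < δ' ∧ δ < t₀ :=
    ⟨min δ' t₀ / 2, by positivity, by linarith [min_le_left δ' t₀, lt_min hδ' ht],
      by linarith [min_le_right δ' t₀, lt_min hδ' ht]⟩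
  set ρ := max (c (t₀ - δ)) (c (t₀ + δ)) with hρ
  have hρ1 : ρ < 1 := by
    apply max_lt
    · apply c_lt; intro h; rw [div_eq_one_iff_eq ht.ne'] at h; linarith
    · apply c_lt; intro h; rw [div_eq_one_iff_eq ht.ne'] at h; linarith
  have hρ0 : 0 < ρ := lt_max_of_lt_right (by simp only [hcdef]; positivity)
  have hout : ∀ t, 0 < t → δ ≤ |t - t₀| → c t ≤ ρ := by
    intro t ht' hd
    rcases le_abs.1 hd with h1 | h1
    · refine le_trans ?_ (le_max_right _ _)
      apply c_le (by positivity) (by positivity)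
      left
      exact ⟨by rw [le_div_iff₀ ht]; linarith, by gcongr; linarith⟩
    · refine le_trans ?_ (le_max_left _ _)
      have : 0 < t₀ - δ := by linarith
      apply c_le (by positivity) (by positivity)
      right
      exact ⟨by rw [div_le_iff₀ ht]; linarith, by gcongr; linarith⟩
  obtain ⟨ρ', hρρ', hρ'1⟩ := exists_between hρ1
  have ev2 : ∀ᶠ t in nhds t₀, ρ' < c t :=
    hcc.continuousAt.eventually_const_lt (by rw [hc0]; exact hρ'1)
  obtain ⟨ε', hε', hb2'⟩ := Metric.eventually_nhds_iff.1 ev2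
  obtain ⟨ε, hε, hε2, hε3⟩ : ∃ ε, 0 < ε ∧ ε < ε' ∧ ε < δ :=
    ⟨min ε' δ / 2, by positivity, by linarith [min_le_left ε' δ, lt_min hε' hδ],
      by linarith [min_le_right ε' δ, lt_min hε' hδ]⟩
  set A := Ioo (t₀ - ε) (t₀ + ε) with hA
  have hcn : ∀ t, 0 < t → 0 ≤ c t := fun t ht' => by simp only [hcdef]; positivity
  have hc1 : ∀ t, c t ≤ 1 := by
    intro t
    by_cases h : t / t₀ = 1
    · simp [hcdef, h]
    · exact (c_lt h).le
  have key : ∀ n : ℕ, ρ' ^ n * (η * (2 * ε)) ≤ ρ ^ n * ∫ t in Ioi (0:ℝ), |g t| := by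
    intro n
    have pt : ∀ t ∈ Ioi (0:ℝ), c t ^ n * g t ≤
        ρ ^ n * |g t| - A.indicator (fun _ => ρ' ^ n * η) t := by
      intro t ht'
      have ht' : 0 < t := ht'
      by_cases hd : δ ≤ |t - t₀|
      · have : t ∉ A := by
          intro hm
          have : |t - t₀| < ε := abs_lt.2 ⟨by linarith [hm.1], by linarith [hm.2]⟩
          linarith
        rw [indicator_of_notMem this, sub_zero]
        calc c t ^ n * g t ≤ c t ^ n * |g t| := by
              have := pow_nonneg (hcn t ht') n
              gcongr
              exact le_abs_self _
          _ ≤ _ := by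
              have := hcn t ht'
              gcongr
              exact hout t ht' hd
      · push Not at hd
        have hgt : g t < -η := hb' (by rw [Real.dist_eq]; linarith)
        have hρg : 0 ≤ ρ ^ n * |g t| := by positivity
        have hcp := pow_nonneg (hcn t ht') n
        by_cases hm : t ∈ A
        · rw [indicator_of_mem hm]
          have : |t - t₀| < ε := abs_lt.2 ⟨by linarith [hm.1], by linarith [hm.2]⟩
          have h3 : ρ' < c t := hb2' (by rw [Real.dist_eq]; linarith)
          have h4 : ρ' ^ n ≤ c t ^ n := by
            have : 0 ≤ ρ' := by linarith
            gcongr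
          nlinarith
        · rw [indicator_of_notMem hm]
          nlinarith
    have iA : IntegrableOn (A.indicator (fun _ => ρ' ^ n * η)) (Ioi (0:ℝ)) := by
      apply Integrable.integrableOn
      rw [integrable_indicator_iff measurableSet_Ioo]
      exact integrableOn_const (by simp [hA])
    have iL : IntegrableOn (fun t => c t ^ n * g t) (Ioi 0) := by
      refine hg.norm.mono' ?_ ?_
      · exact (hcc.pow n).aestronglyMeasurable.mul hg.1
      · filter_upwards [ae_restrict_mem measurableSet_Ioi] with t ht'
        rw [norm_mul, norm_pow, Real.norm_of_nonneg (hcn t ht')]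
        exact mul_le_of_le_one_left (norm_nonneg _) (pow_le_one₀ (hcn t ht') (hc1 t))
    have iR : IntegrableOn (fun t => ρ ^ n * |g t|) (Ioi 0) := hg.abs.const_mul _
    have := setIntegral_mono_on iL (iR.sub iA) measurableSet_Ioi pt
    have h0 := (h n).trans this
    simp only [Pi.sub_apply] at h0
    rw [integral_sub iR iA, integral_const_mul, setIntegral_indicator measurableSet_Ioo,
      inter_eq_right.2 (fun t ht' => by have := ht'.1; simp only [mem_Ioi]; linarith)] at h0
    simp only [integral_const, MeasurableSet.univ, measureReal_restrict_apply, univ_inter,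
      smul_eq_mul] at h0
    rw [Real.volume_real_Ioo_of_le (by linarith)] at h0
    linarith
  have lim : Tendsto (fun n : ℕ => (ρ' / ρ) ^ n) atTop atTop :=
    tendsto_pow_atTop_atTop_of_one_lt (by rw [lt_div_iff₀ hρ0]; linarith)
  have hpos : 0 < η * (2 * ε) := by positivity
  obtain ⟨n, hn⟩ := (lim.eventually_gt_atTop ((∫ t in Ioi (0:ℝ), |g t|) / (η * (2 * ε)))).exists
  have := key n
  rw [div_pow, lt_div_iff₀ (by positivity), div_mul_eq_mul_div, div_lt_iff₀ hpos] at hn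
  linarith

lemma gamma_lower {A y : ℝ} (hA : 0 < A) (hy : 1 ≤ y) :
    A ^ (y - 1) * Real.exp (-A) ≤ Real.Gamma y := by
  rw [Real.Gamma_eq_integral (by linarith)]
  have i1 := Real.GammaIntegral_convergent (s := y) (by linarith)
  calc A ^ (y - 1) * Real.exp (-A) = ∫ t in Ioi A, A ^ (y - 1) * Real.exp (-t) := by
        rw [integral_const_mul, integral_exp_neg_Ioi]
    _ ≤ ∫ t in Ioi A, Real.exp (-t) * t ^ (y - 1) := by
        refine setIntegral_mono_on ?_ (i1.mono_set (Ioi_subset_Ioi hA.le)) measurableSet_Ioi ?_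
        · exact (integrableOn_exp_neg_Ioi A).const_mul _
        · intro t ht
          have ht : A < t := ht
          rw [mul_comm]
          gcongr
    _ ≤ ∫ t in Ioi 0, Real.exp (-t) * t ^ (y - 1) := by
        refine setIntegral_mono_set i1 ?_ (Ioi_subset_Ioi hA.le).eventuallyLE
        filter_upwards [ae_restrict_mem measurableSet_Ioi] with t ht
        have ht : 0 < t := ht
        simp only [Pi.zero_apply]
        positivity

lemma ml_summable {β R : ℝ} (h0 : 0 < β) (hR : 0 ≤ R) :
    Summable (fun n : ℕ => R ^ n / Real.Gamma (n * β + β)) := by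
  set A := (2 * (R + 1)) ^ (1 / β) with hA
  have hApos : 0 < A := by positivity
  have hAβ : A ^ β = 2 * (R + 1) := by
    rw [hA, ← Real.rpow_mul (by positivity)]; field_simp; simp
  have hgeo : Summable (fun n : ℕ => (Real.exp A * A ^ (1 - β)) * (1 / 2 : ℝ) ^ n) :=
    (summable_geometric_of_lt_one (by norm_num) (by norm_num)).mul_left _
  refine Summable.of_norm_bounded_eventually_nat hgeo ?_
  have ev : ∀ᶠ n : ℕ in atTop, 1 ≤ (n : ℝ) * β + β := by
    have : Tendsto (fun n : ℕ => (n : ℝ) * β) atTop atTop :=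
      tendsto_natCast_atTop_atTop.atTop_mul_const h0
    filter_upwards [this.eventually_ge_atTop 1] with n hn
    linarith
  filter_upwards [ev] with n hn
  have hg := gamma_lower hApos hn
  have hgp : 0 < Real.Gamma (n * β + β) := Real.Gamma_pos_of_pos (by linarith)
  rw [Real.norm_of_nonneg (by positivity), div_le_iff₀ hgp]
  have e1 : A ^ (n * β + β - 1) = (2 * (R + 1)) ^ n * A ^ (β - 1) := by
    rw [show (n:ℝ) * β + β - 1 = β * n + (β - 1) by ring, Real.rpow_add hApos, Real.rpow_mul hApos.le,
      hAβ, Real.rpow_natCast]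
  rw [e1] at hg
  have e2 : A ^ (1 - β) * A ^ (β - 1) = 1 := by
    rw [← Real.rpow_add hApos]; simp
  have e3 : Real.exp A * Real.exp (-A) = 1 := by rw [← Real.exp_add]; simp
  calc R ^ n ≤ (R + 1) ^ n := by gcongr; linarith
    _ = (Real.exp A * A ^ (1 - β) * (1 / 2) ^ n) *
        ((2 * (R + 1)) ^ n * A ^ (β - 1) * Real.exp (-A)) := by
        have : ((1:ℝ) / 2) ^ n * (2 * (R + 1)) ^ n = (R + 1) ^ n := by
          rw [← mul_pow]; ring_nf
        calc (R + 1) ^ n = (Real.exp A * Real.exp (-A)) * (A ^ (1 - β) * A ^ (β - 1)) *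
              (((1:ℝ) / 2) ^ n * (2 * (R + 1)) ^ n) := by rw [e3, e2, this]; ring
          _ = _ := by ring
    _ ≤ _ := by gcongr

lemma ml_continuous {β : ℝ} (h0 : 0 < β) : Continuous (fun z => ML2 β β z) := by
  rw [continuous_iff_continuousAt]
  intro z
  have : ContinuousOn (fun z => ML2 β β z) (Icc (-(|z| + 1)) (|z| + 1)) := by
    refine continuousOn_tsum (u := fun n : ℕ => (|z| + 1) ^ n / Real.Gamma (n * β + β))
      (fun n => by fun_prop) (ml_summable h0 (by positivity)) ?_
    intro n x hx
    have hgp : 0 < Real.Gamma (n * β + β) := Real.Gamma_pos_of_pos (by positivity)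
    rw [norm_div, norm_pow, Real.norm_of_nonneg hgp.le]
    gcongr
    exact abs_le.2 hx
  refine this.continuousAt (Icc_mem_nhds ?_ ?_)
  · linarith [neg_abs_le z]
  · linarith [le_abs_self z]

lemma fML_continuousOn {β : ℝ} (h0 : 0 < β) : ContinuousOn (fML β) (Ioi 0) := by
  unfold fML
  have h1 : ∀ p : ℝ, ContinuousOn (fun t : ℝ => t ^ p) (Ioi 0) := fun p =>
    continuousOn_id.rpow_const (fun t ht => Or.inl (ne_of_gt ht))
  exact (h1 _).mul ((ml_continuous h0).comp_continuousOn (h1 β).neg)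

lemma fML_laplace {β s : ℝ} (h0 : 0 < β) (hs : 1 < s) :
    ∫ t in Ioi (0:ℝ), fML β t * Real.exp (-(s * t)) = 1 / (1 + s ^ β) := by
  have hs0 : 0 < s := by linarith
  have hsβ : 1 < s ^ β := Real.one_lt_rpow hs h0
  set q := (1 / s) ^ β with hq
  have hqpos : 0 < q := by positivity
  have hqs : q * s ^ β = 1 := by
    rw [hq, ← Real.mul_rpow (by positivity) hs0.le]; field_simp; simp
  have hq1 : q < 1 := by nlinarith
  set F : ℕ → ℝ → ℝ := fun n t =>
    (t ^ (β - 1) * ((-(t ^ β)) ^ n / Real.Gamma (n * β + β))) * Real.exp (-(s * t)) with hF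
  have hpos : ∀ n : ℕ, 0 < (n:ℝ) * β + β := fun n => by positivity
  have hFe : ∀ n : ℕ, ∀ t ∈ Ioi (0:ℝ), F n t = ((-1) ^ n / Real.Gamma (n * β + β)) *
      (t ^ (n * β + β - 1) * Real.exp (-(s * t))) := by
    intro n t ht
    have ht : 0 < t := ht
    have : t ^ (n * β + β - 1) = t ^ (β - 1) * (t ^ β) ^ n := by
      rw [show (n:ℝ) * β + β - 1 = (β - 1) + β * n by ring, Real.rpow_add ht, Real.rpow_mul ht.le,
        Real.rpow_natCast]
    simp only [hF]
    rw [this, neg_pow]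
    ring
  have hval : ∀ n : ℕ, ∫ t in Ioi (0:ℝ), t ^ (n * β + β - 1) * Real.exp (-(s * t)) =
      q ^ (n + 1) * Real.Gamma (n * β + β) := by
    intro n
    rw [Real.integral_rpow_mul_exp_neg_mul_Ioi (hpos n) hs0,
      show (n:ℝ) * β + β = β * ((n + 1 : ℕ) : ℝ) by push_cast; ring,
      Real.rpow_mul (by positivity), Real.rpow_natCast]
  have hint : ∀ n : ℕ, IntegrableOn (fun t => t ^ (n * β + β - 1) * Real.exp (-(s * t))) (Ioi 0) := by
    intro n
    refine Integrable.of_integral_ne_zero ?_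
    rw [hval n]
    have := Real.Gamma_pos_of_pos (hpos n)
    positivity
  have hFint : ∀ n, Integrable (F n) (volume.restrict (Ioi 0)) := fun n =>
    IntegrableOn.congr_fun ((hint n).const_mul _) (fun t ht => (hFe n t ht).symm) measurableSet_Ioi
  have hsum := hasSum_integral_of_summable_integral_norm hFint (by
    have : ∀ n, ∫ t in Ioi (0:ℝ), ‖F n t‖ = q ^ (n + 1) := by
      intro n
      have hg := Real.Gamma_pos_of_pos (hpos n)
      calc ∫ t in Ioi (0:ℝ), ‖F n t‖ = ∫ t in Ioi (0:ℝ), (1 / Real.Gamma (n * β + β)) *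
            (t ^ (n * β + β - 1) * Real.exp (-(s * t))) := by
            refine setIntegral_congr_fun measurableSet_Ioi (fun t ht => ?_)
            have ht' : 0 < t := ht
            rw [hFe n t ht, norm_mul, norm_div, norm_pow, norm_neg, norm_one, one_pow,
              Real.norm_of_nonneg hg.le, Real.norm_of_nonneg (by positivity)]
        _ = _ := by
            rw [integral_const_mul, hval n]; field_simp
    simp_rw [this]
    exact (summable_nat_add_iff 1).2 (summable_geometric_of_lt_one hqpos.le hq1))
  have hI : ∀ n, ∫ t in Ioi (0:ℝ), F n t = q * (-q) ^ n := by
    intro n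
    have hg := Real.Gamma_pos_of_pos (hpos n)
    rw [setIntegral_congr_fun measurableSet_Ioi (hFe n), integral_const_mul, hval n, neg_pow q]
    field_simp
    ring
  have hT : ∀ t, ∑' n, F n t = fML β t * Real.exp (-(s * t)) := by
    intro t
    simp only [hF]
    rw [tsum_mul_right, tsum_mul_left]
    rfl
  simp_rw [hT, hI] at hsum
  have h2 := (hasSum_geometric_of_norm_lt_one (ξ := -q)
    (by rw [norm_neg, Real.norm_of_nonneg hqpos.le]; exact hq1)).mul_left q
  rw [hsum.unique h2]
  have : 0 < 1 + q := by linarith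
  have h3 : 0 < 1 + s ^ β := by positivity
  rw [sub_neg_eq_add]
  field_simp
  linarith

lemma fML_integrable {β s : ℝ} (h0 : 0 < β) (hs : 1 < s) :
    IntegrableOn (fun t => fML β t * Real.exp (-(s * t))) (Ioi 0) := by
  refine Integrable.of_integral_ne_zero ?_
  rw [fML_laplace h0 hs]
  have : 0 < s := by linarith
  positivity

lemma mom_integrable {β a : ℝ} (h0 : 0 < β) (ha : 1 < a) (n : ℕ) :
    IntegrableOn (fun t => t ^ n * fML β t * Real.exp (-(a * t))) (Ioi 0) := by
  set d := (a - 1) / 2 with hd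
  have hdp : 0 < d := by linarith
  have hi := (fML_integrable (β := β) (s := a - d) h0 (by linarith)).norm.const_mul (n.factorial / d ^ n)
  refine Integrable.mono' hi ?_ ?_
  · refine ContinuousOn.aestronglyMeasurable ?_ measurableSet_Ioi
    exact (ContinuousOn.mul (by fun_prop) (fML_continuousOn h0)).mul (by fun_prop)
  · filter_upwards [ae_restrict_mem measurableSet_Ioi] with t ht
    have ht : 0 < t := ht
    have h1 := Real.pow_div_factorial_le_exp (d * t) (by positivity) n
    rw [div_le_iff₀ (by positivity), mul_pow] at h1
    have h2 : t ^ n ≤ n.factorial / d ^ n * Real.exp (d * t) := by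
      rw [div_mul_eq_mul_div, le_div_iff₀ (by positivity)]; linarith
    rw [norm_mul, norm_mul, norm_mul, Real.norm_of_nonneg (Real.exp_pos _).le,
      Real.norm_of_nonneg (Real.exp_pos _).le, Real.norm_of_nonneg (by positivity : 0 ≤ t ^ n)]
    calc t ^ n * ‖fML β t‖ * Real.exp (-(a * t)) ≤
        (n.factorial / d ^ n * Real.exp (d * t)) * ‖fML β t‖ * Real.exp (-(a * t)) := by gcongr
      _ = n.factorial / d ^ n * (‖fML β t‖ * (Real.exp (d * t) * Real.exp (-(a * t)))) := by ring
      _ = _ := by rw [← Real.exp_add]; ring_nf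

/-- complex moments -/
noncomputable def Hc (β : ℝ) (n : ℕ) (z : ℂ) : ℂ :=
  ∫ t in Ioi (0:ℝ), ((t ^ n * fML β t : ℝ) : ℂ) * Complex.exp (-(z * t))

lemma Hc_meas {β : ℝ} (h0 : 0 < β) (n : ℕ) (z : ℂ) :
    AEStronglyMeasurable (fun t : ℝ => ((t ^ n * fML β t : ℝ) : ℂ) * Complex.exp (-(z * t)))
      (volume.restrict (Ioi 0)) := by
  refine ContinuousOn.aestronglyMeasurable ?_ measurableSet_Ioi
  refine ContinuousOn.mul ?_ (by fun_prop)
  exact Complex.continuous_ofReal.comp_continuousOn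
    (ContinuousOn.mul (by fun_prop) (fML_continuousOn h0))

lemma Hc_norm (β : ℝ) (n : ℕ) (z : ℂ) (t : ℝ) :
    ‖((t ^ n * fML β t : ℝ) : ℂ) * Complex.exp (-(z * t))‖ =
      ‖t ^ n * fML β t * Real.exp (-(z.re * t))‖ := by
  rw [norm_mul, norm_mul, Complex.norm_real, Complex.norm_exp,
    Real.norm_of_nonneg (Real.exp_pos _).le]
  simp

lemma Hc_integrable {β : ℝ} (h0 : 0 < β) (n : ℕ) {z : ℂ} (hz : 1 < z.re) :
    IntegrableOn (fun t : ℝ => ((t ^ n * fML β t : ℝ) : ℂ) * Complex.exp (-(z * t))) (Ioi 0) := by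
  refine (mom_integrable h0 hz n).norm.mono' (Hc_meas h0 n z) ?_
  filter_upwards with t
  exact (Hc_norm β n z t).le

lemma Hc_ofReal (β : ℝ) (n : ℕ) (s : ℝ) :
    Hc β n s = ((∫ t in Ioi (0:ℝ), t ^ n * fML β t * Real.exp (-(s * t)) : ℝ) : ℂ) := by
  rw [← integral_complex_ofReal, Hc]
  congr 1
  ext t
  push_cast
  rfl

lemma Hc_deriv {β : ℝ} (h0 : 0 < β) (n : ℕ) {z : ℂ} (hz : 1 < z.re) :
    HasDerivAt (Hc β n) (-(Hc β (n + 1) z)) z := by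
  obtain ⟨a, ha1, ha2⟩ := exists_between hz
  have hU : {w : ℂ | a < w.re} ∈ nhds z :=
    (isOpen_lt continuous_const Complex.continuous_re).mem_nhds ha2
  have := (hasDerivAt_integral_of_dominated_loc_of_deriv_le
    (μ := volume.restrict (Ioi (0:ℝ)))
    (F := fun (w : ℂ) (t : ℝ) => ((t ^ n * fML β t : ℝ) : ℂ) * Complex.exp (-(w * t)))
    (F' := fun (w : ℂ) (t : ℝ) => -(((t ^ (n + 1) * fML β t : ℝ) : ℂ) * Complex.exp (-(w * t))))
    (bound := fun t => ‖t ^ (n + 1) * fML β t * Real.exp (-(a * t))‖) (x₀ := z)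
    hU (Eventually.of_forall fun w => Hc_meas h0 n w) (Hc_integrable h0 n hz)
    (Hc_meas h0 (n + 1) z).neg ?_ (mom_integrable h0 ha1 (n + 1)).norm ?_).2
  · rw [integral_neg] at this
    exact this
  · filter_upwards [ae_restrict_mem measurableSet_Ioi] with t ht w hw
    have ht : 0 < t := ht
    have hw : a < w.re := hw
    rw [norm_neg, Hc_norm, norm_mul, norm_mul (t ^ (n + 1) * fML β t),
      Real.norm_of_nonneg (Real.exp_pos _).le, Real.norm_of_nonneg (Real.exp_pos _).le]
    gcongr
  · filter_upwards with t w hw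
    have h1 : HasDerivAt (fun w : ℂ => -(w * t)) (-(t:ℂ)) w := by
      exact ((hasDerivAt_id w).mul_const (t:ℂ)).neg.congr_deriv (by simp)
    refine (h1.cexp.const_mul (((t ^ n * fML β t : ℝ) : ℂ))).congr_deriv ?_
    push_cast
    ring

lemma fML_nonneg {β : ℝ} (h0 : 0 < β) (h1 : β ≤ 1) {t : ℝ} (ht : 0 < t) : 0 ≤ fML β t := by
  set H : ℕ → ℝ → ℝ := fun n s => (Hc β n s).re with hH
  have hHe : ∀ n s, H n s = ∫ t in Ioi (0:ℝ), t ^ n * fML β t * Real.exp (-(s * t)) := by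
    intro n s
    simp only [hH]
    rw [Hc_ofReal, Complex.ofReal_re]
  have hHd : ∀ n s, 1 < s → HasDerivAt (H n) (-(H (n + 1) s)) s := fun n s hs =>
    (Hc_deriv h0 n (z := (s:ℂ)) (by simpa using hs)).real_of_complex
  have hpos : ∀ n s, 1 < s → 0 ≤ H n s := by
    intro n s hs
    have := CMn.transfer hHd n 0 _ (CMn.main (n := n) h0 h1) (fun u hu => ?_) s hs
    · simpa using this
    · rw [hHe, ← fML_laplace h0 hu]
      simp
  have hc : ContinuousAt (fun u => fML β u * Real.exp (-(2 * u))) t :=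
    ((fML_continuousOn h0).continuousAt (Ioi_mem_nhds ht)).mul (by fun_prop)
  have := peak_nonneg ht (fML_integrable h0 one_lt_two) hc (fun n => ?_)
  · exact nonneg_of_mul_nonneg_left this (Real.exp_pos _)
  · have h2 := hpos n (n / t + 2) (by have : 0 ≤ n / t := by positivity
                                      linarith)
    rw [hHe] at h2
    have : ∀ u : ℝ, ((u / t) * Real.exp (1 - u / t)) ^ n * (fML β u * Real.exp (-(2 * u))) =
        (Real.exp n / t ^ n) * (u ^ n * fML β u * Real.exp (-((n / t + 2) * u))) := by
      intro u
      have e : Real.exp (1 - u / t) ^ n * Real.exp (-(2 * u)) =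
          Real.exp n * Real.exp (-((n / t + 2) * u)) := by
        rw [← Real.exp_nat_mul, ← Real.exp_add, ← Real.exp_add]
        congr 1
        ring
      calc _ = (u / t) ^ n * fML β u * (Real.exp (1 - u / t) ^ n * Real.exp (-(2 * u))) := by ring
        _ = _ := by rw [e]; ring
    simp_rw [this]
    rw [integral_const_mul]
    positivity

lemma one_add_cpow_ne {β : ℝ} (h0 : 0 < β) (h1 : β ≤ 1) {z : ℂ} (hz : 0 < z.re) :
    1 + z ^ (β : ℂ) ≠ 0 := by
  intro h
  have h2 : (z ^ (β : ℂ)).re = -1 := by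
    have := congrArg Complex.re h
    simp only [Complex.add_re, Complex.one_re, Complex.zero_re] at this
    linarith
  rw [Complex.cpow_ofReal_re] at h2
  have h3 : |z.arg| < Real.pi / 2 := Complex.abs_arg_lt_pi_div_two_iff.2 (Or.inl hz)
  have h4 : |z.arg * β| ≤ Real.pi / 2 := by
    rw [abs_mul, abs_of_pos h0]
    nlinarith [abs_nonneg z.arg]
  have h5 := Real.cos_nonneg_of_mem_Icc (abs_le.1 h4)
  have : 0 ≤ ‖z‖ ^ β := by positivity
  nlinarith

lemma Gc_diff {β : ℝ} (h0 : 0 < β) (h1 : β ≤ 1) :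
    DifferentiableOn ℂ (fun z : ℂ => 1 / (1 + z ^ (β : ℂ))) {z | 0 < z.re} := by
  intro z hz
  have hz : 0 < z.re := hz
  refine DifferentiableAt.differentiableWithinAt ?_
  refine (differentiableAt_const _).div ((differentiableAt_const _).add ?_) (one_add_cpow_ne h0 h1 hz)
  exact differentiableAt_id.cpow_const (Or.inl hz)

lemma Hc_eq {β : ℝ} (h0 : 0 < β) (h1 : β ≤ 1) {z : ℂ} (hz : 1 < z.re) :
    Hc β 0 z = 1 / (1 + z ^ (β : ℂ)) := by
  have hopen : IsOpen {z : ℂ | 1 < z.re} := isOpen_lt continuous_const Complex.continuous_re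
  have a1 : AnalyticOnNhd ℂ (Hc β 0) {z | 1 < z.re} := DifferentiableOn.analyticOnNhd
    (fun w hw => (Hc_deriv h0 0 hw).differentiableAt.differentiableWithinAt) hopen
  have a2 : AnalyticOnNhd ℂ (fun z : ℂ => 1 / (1 + z ^ (β : ℂ))) {z | 1 < z.re} :=
    DifferentiableOn.analyticOnNhd ((Gc_diff h0 h1).mono (fun w hw => by
      have : 1 < w.re := hw
      show 0 < w.re
      linarith)) hopen
  refine a1.eqOn_of_preconnected_of_frequently_eq a2 (convex_halfSpace_re_gt 1).isPreconnected
    (z₀ := ((2:ℝ):ℂ)) (by simp) ?_ hz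
  have hreal : ∀ s : ℝ, 1 < s → Hc β 0 s = 1 / (1 + (s:ℂ) ^ (β : ℂ)) := by
    intro s hs
    rw [Hc_ofReal]
    simp only [pow_zero, one_mul]
    rw [fML_laplace h0 hs, ← Complex.ofReal_cpow (by linarith)]
    push_cast
    rfl
  have ht : Tendsto (fun s : ℝ => (s:ℂ)) (nhdsWithin 2 {2}ᶜ) (nhdsWithin ((2:ℝ):ℂ) {((2:ℝ):ℂ)}ᶜ) := by
    refine tendsto_nhdsWithin_iff.2 ⟨Complex.continuous_ofReal.continuousAt.tendsto.mono_left
      nhdsWithin_le_nhds, ?_⟩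
    filter_upwards [self_mem_nhdsWithin] with s hs h
    exact hs (Complex.ofReal_injective h)
  refine ht.frequently (Eventually.frequently ?_)
  filter_upwards [nhdsWithin_le_nhds (Ioi_mem_nhds (show (1:ℝ) < 2 by norm_num))] with s hs
  exact hreal s hs

lemma Gc_iter {β : ℝ} (h0 : 0 < β) (h1 : β ≤ 1) (n : ℕ) : ∀ {z : ℂ}, 1 < z.re →
    iteratedDeriv n (fun z : ℂ => 1 / (1 + z ^ (β : ℂ))) z = (-1) ^ n * Hc β n z := by
  induction n with
  | zero => intro z hz; simp only [iteratedDeriv_zero, pow_zero, one_mul]; rw [Hc_eq h0 h1 hz]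
  | succ n ih =>
    intro z hz
    rw [iteratedDeriv_succ]
    have e : iteratedDeriv n (fun z : ℂ => 1 / (1 + z ^ (β : ℂ))) =ᶠ[nhds z]
        fun w => (-1) ^ n * Hc β n w := by
      filter_upwards [(isOpen_lt continuous_const Complex.continuous_re).mem_nhds hz] with w hw
      exact ih hw
    rw [e.deriv_eq, ((Hc_deriv h0 n hz).const_mul _).deriv]
    ring

/-- Laplace transform of the Mittag-Leffler density:
`∫_0^∞ f_β(t) e^{-st} dt = 1/(1+s^β)` for `β ∈ (0,1]`, `s > 0`. -/
theorem laplace_mittagLeffler_density (β : ℝ) (hβ : β ∈ Set.Ioc (0:ℝ) 1)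
    (s : ℝ) (hs : 0 < s) :
    ∫ t in Set.Ioi (0:ℝ), fML β t * Real.exp (-(s * t)) = 1 / (1 + s ^ β) := by
  obtain ⟨h0, h1⟩ := hβ
  set a : ℝ := s + 2 with ha
  have hT := Complex.hasSum_taylorSeries_on_ball (f := fun z : ℂ => 1 / (1 + z ^ (β : ℂ)))
    (c := (a : ℂ)) (r := a) (z := (s : ℂ)) ((Gc_diff h0 h1).mono (fun w hw => by
      have h2 : ‖w - a‖ < a := by simpa [dist_eq_norm] using hw
      have h3 := (abs_le.1 (Complex.abs_re_le_norm (w - a))).1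
      simp only [Complex.sub_re, Complex.ofReal_re] at h3
      show 0 < w.re
      linarith)) (by
      rw [Metric.mem_ball, dist_eq_norm, ← Complex.ofReal_sub, Complex.norm_real, Real.norm_eq_abs,
        ha]
      rw [abs_lt]; constructor <;> linarith)
  set F : ℕ → ℝ → ℝ := fun n t =>
    (2 ^ n / n.factorial) * (t ^ n * fML β t * Real.exp (-(a * t))) with hF
  have hFint : ∀ n, Integrable (F n) (volume.restrict (Ioi 0)) := fun n =>
    (mom_integrable h0 (by linarith) n).const_mul _
  have hterm : ∀ n : ℕ, ((n.factorial : ℂ))⁻¹ • ((s:ℂ) - a) ^ n •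
      iteratedDeriv n (fun z : ℂ => 1 / (1 + z ^ (β : ℂ))) a =
      ((∫ t in Ioi (0:ℝ), F n t : ℝ) : ℂ) := by
    intro n
    rw [Gc_iter h0 h1 n (by simp only [Complex.ofReal_re]; linarith), Hc_ofReal]
    simp only [hF]
    rw [integral_const_mul, ha]
    push_cast
    rw [show (s:ℂ) - (s + 2) = -2 by ring, neg_pow (2:ℂ), smul_eq_mul, smul_eq_mul]
    have : ((-1:ℂ)) ^ n * (-1) ^ n = 1 := by rw [← mul_pow]; simp
    linear_combination (((n.factorial : ℂ))⁻¹ * 2 ^ n *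
      ((∫ t in Ioi (0:ℝ), t ^ n * fML β t * Real.exp (-((s + 2) * t)) : ℝ) : ℂ)) * this
  have hval : (1 / (1 + (s:ℂ) ^ (β : ℂ))) = ((1 / (1 + s ^ β) : ℝ) : ℂ) := by
    push_cast
    rw [Complex.ofReal_cpow hs.le]
  simp_rw [hterm] at hT
  rw [hval] at hT
  have hT' := Complex.hasSum_ofReal.1 hT
  have hnn : ∀ n, ∫ t in Ioi (0:ℝ), ‖F n t‖ = ∫ t in Ioi (0:ℝ), F n t := by
    intro n
    refine setIntegral_congr_fun measurableSet_Ioi (fun t ht => ?_)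
    have ht' : 0 < t := ht
    have := fML_nonneg h0 h1 ht'
    exact Real.norm_of_nonneg (by simp only [hF]; positivity)
  have hsum := hasSum_integral_of_summable_integral_norm hFint (by
    simp_rw [hnn]; exact hT'.summable)
  rw [← hsum.unique hT']
  congr 1
  ext t
  have hexp : HasSum (fun n : ℕ => (2 * t) ^ n / n.factorial) (Real.exp (2 * t)) := by
    rw [Real.exp_eq_exp_ℝ]
    exact NormedSpace.expSeries_div_hasSum_exp (2 * t)
  have h3 := (hexp.mul_left (fML β t * Real.exp (-(a * t))))
  have h4 : ∀ n, fML β t * Real.exp (-(a * t)) * ((2 * t) ^ n / n.factorial) = F n t := by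
    intro n; simp only [hF]; rw [mul_pow]; ring
  simp_rw [h4] at h3
  rw [h3.tsum_eq, mul_assoc, ← Real.exp_add, ha]
  ring_nf
end

section
/- Let β ∈ (0,1). For every t > 0, the Mittag-Leffler survival function admits the spectral representation E_β(-t^β) = ∫_0^∞ e^{-θt} K_β(θ) dθ, where K_β(θ) = (1/π) · θ^{β-1} sin(βπ) / (θ^{2β} + 2 θ^β cos(βπ) + 1). -/
open MeasureTheory Set Filter

/-- jump across the cut -/
noncomputable def mlDl (g : ℂ → ℂ) (x : ℝ) : ℂ :=
  g (x + Real.pi * Complex.I) - g (x + (-Real.pi : ℝ) * Complex.I)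

/-- segment integral -/
noncomputable def mlRR (g : ℂ → ℂ) (x : ℝ) : ℂ :=
  ∫ y in (-Real.pi)..Real.pi, g (x + y * Complex.I)

/-- Hankel type functional -/
noncomputable def mlJ (g : ℂ → ℂ) : ℂ :=
  Complex.I * mlRR g 1 + ∫ x in Ioi (1:ℝ), mlDl g x

/-- model functions -/
noncomputable def mlg (t b : ℝ) (w : ℂ) : ℂ := Complex.exp (t * Complex.exp w) * Complex.exp (b * w)

lemma ml_strip (g : ℂ → ℂ) (hg : ∀ w : ℂ, |w.im| ≤ Real.pi → DifferentiableAt ℂ g w)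
    (C ε M : ℝ) (hε : 0 < ε)
    (hb : ∀ x y : ℝ, x ≤ M → |y| ≤ Real.pi → ‖g (x + y * Complex.I)‖ ≤ C * Real.exp (ε * x))
    (hi : Integrable (mlDl g)) : mlJ g = ∫ x, mlDl g x := by
  have hpi := Real.pi_pos
  have hc : ∀ y : ℝ, |y| ≤ Real.pi → Continuous fun x : ℝ => g (x + y * Complex.I) := by
    intro y hy
    rw [continuous_iff_continuousAt]
    intro x
    have h1 : ContinuousAt g (x + y * Complex.I) := (hg _ (by simpa using hy)).continuousAt
    exact ContinuousAt.comp (f := fun x : ℝ => (x + y * Complex.I : ℂ)) h1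
      (by fun_prop)
  have hrect : ∀ x1 : ℝ, Complex.I * mlRR g 1 - Complex.I * mlRR g x1
      = ∫ x in x1..1, mlDl g x := by
    intro x1
    have := Complex.integral_boundary_rect_eq_zero_of_differentiableOn g
      (x1 + (-Real.pi : ℝ) * Complex.I) (1 + Real.pi * Complex.I) (by
        intro w hw
        apply DifferentiableAt.differentiableWithinAt
        apply hg
        rw [Complex.mem_reProdIm] at hw
        have h2 := hw.2
        simp at h2
        rw [uIcc_of_le (by linarith)] at h2
        exact abs_le.2 h2)
    simp only [Complex.add_re, Complex.add_im, Complex.mul_re, Complex.mul_im, Complex.ofReal_re,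
      Complex.ofReal_im, Complex.I_re, Complex.I_im, Complex.one_re, Complex.one_im, mul_zero, mul_one,
      sub_zero, add_zero, zero_add, smul_eq_mul] at this
    unfold mlDl mlRR
    rw [intervalIntegral.integral_sub]
    · linear_combination this
    · exact (hc _ (by rw [abs_of_pos hpi])).intervalIntegrable _ _
    · exact (hc _ (by rw [abs_neg, abs_of_pos hpi])).intervalIntegrable _ _
  have hlim : Tendsto (fun x1 => mlRR g x1) atBot (nhds 0) := by
    have hE : Tendsto (fun x : ℝ => (C * Real.exp (ε * x)) * |Real.pi - -Real.pi|) atBot (nhds 0) := by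
      have : Tendsto (fun x : ℝ => Real.exp (ε * x)) atBot (nhds 0) :=
        Real.tendsto_exp_atBot.comp (tendsto_id.const_mul_atBot hε)
      simpa using (this.const_mul C).mul_const (|Real.pi - -Real.pi|)
    refine squeeze_zero_norm' ?_ hE
    filter_upwards [eventually_le_atBot M] with x hx
    apply intervalIntegral.norm_integral_le_of_norm_le_const
    intro y hy
    rw [uIoc_of_le (by linarith)] at hy
    exact hb x y hx (abs_le.2 ⟨hy.1.le, hy.2⟩)
  have h1 := intervalIntegral_tendsto_integral_Iic (μ := volume) (f := mlDl g) (1:ℝ) hi.integrableOn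
    (tendsto_id (α := ℝ) (x := atBot))
  have h2 : Tendsto (fun x1 => ∫ x in x1..1, mlDl g x) atBot (nhds (Complex.I * mlRR g 1)) := by
    simp only [← hrect]
    simpa using (hlim.const_mul Complex.I).const_sub (Complex.I * mlRR g 1)
  have h3 := tendsto_nhds_unique h1 h2
  unfold mlJ
  rw [← h3, ← intervalIntegral.integral_Iic_add_Ioi hi.integrableOn hi.integrableOn]

lemma ml_exp_pi (x : ℝ) : Complex.exp (x + Real.pi * Complex.I) = ((-Real.exp x : ℝ) : ℂ) := by
  rw [Complex.exp_add, Complex.exp_pi_mul_I]; push_cast; ring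

lemma ml_exp_neg_pi (x : ℝ) :
    Complex.exp (x + (-Real.pi : ℝ) * Complex.I) = ((-Real.exp x : ℝ) : ℂ) := by
  rw [Complex.exp_add, Complex.ofReal_neg, neg_mul, Complex.exp_neg_pi_mul_I]; push_cast; ring

lemma ml_norm_exp (b x y : ℝ) : ‖Complex.exp (b * (x + y * Complex.I))‖ = Real.exp (b * x) := by
  rw [Complex.norm_exp]; simp

lemma mlDl_g (t b x : ℝ) : mlDl (mlg t b) x =
    ((Real.exp (-(t * Real.exp x)) * Real.exp (b * x) * (2 * Real.sin (b * Real.pi)) : ℝ) : ℂ)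
      * Complex.I := by
  unfold mlDl mlg
  rw [ml_exp_pi, ml_exp_neg_pi, mul_add, mul_add, Complex.exp_add, Complex.exp_add]
  have e1 : (b : ℂ) * (Real.pi * Complex.I) = ((b * Real.pi : ℝ) : ℂ) * Complex.I := by
    push_cast; ring
  have e2 : (b : ℂ) * ((-Real.pi : ℝ) * Complex.I) = ((-(b * Real.pi) : ℝ) : ℂ) * Complex.I := by
    push_cast; ring
  rw [e1, e2, Complex.exp_mul_I, Complex.exp_mul_I]
  push_cast
  rw [Complex.cos_neg, Complex.sin_neg, mul_neg]
  ring

lemma ml_int_exp (f : ℝ → ℝ) :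
    ∫ θ in Ioi (0:ℝ), f θ = ∫ x : ℝ, Real.exp x * f (Real.exp x) := by
  have := integral_image_eq_integral_abs_deriv_smul (s := univ) (f := Real.exp) (f' := Real.exp)
    MeasurableSet.univ (fun x _ => (Real.hasDerivAt_exp x).hasDerivWithinAt)
    (Real.exp_injective.injOn) f
  rw [image_univ, Real.range_exp] at this
  simpa using this

lemma ml_intble_exp (f : ℝ → ℝ) :
    IntegrableOn f (Ioi (0:ℝ)) ↔ Integrable fun x : ℝ => Real.exp x * f (Real.exp x) := by
  have := integrableOn_image_iff_integrableOn_abs_deriv_smul (s := univ) (f := Real.exp)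
    (f' := Real.exp)
    MeasurableSet.univ (fun x _ => (Real.hasDerivAt_exp x).hasDerivWithinAt)
    (Real.exp_injective.injOn) f
  rw [image_univ, Real.range_exp] at this
  simpa using this

lemma ml_rw (t b x : ℝ) : Real.exp x * (Real.exp x ^ (b - 1) * Real.exp (-(t * Real.exp x)))
    = Real.exp (-(t * Real.exp x)) * Real.exp (b * x) := by
  rw [← Real.exp_mul, ← Real.exp_add, ← Real.exp_add, ← Real.exp_add]
  congr 1; ring

lemma ml_intble (t b : ℝ) (ht : 0 < t) (hb : 0 < b) :
    Integrable fun x : ℝ => Real.exp (-(t * Real.exp x)) * Real.exp (b * x) := by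
  have h := integrableOn_rpow_mul_exp_neg_mul_rpow (p := 1) (s := b - 1) (b := t) (by linarith)
    one_pos ht
  simp only [Real.rpow_one, neg_mul] at h
  rw [ml_intble_exp] at h
  simpa only [ml_rw] using h

lemma ml_integral (t b : ℝ) (ht : 0 < t) (hb : 0 < b) :
    ∫ x : ℝ, Real.exp (-(t * Real.exp x)) * Real.exp (b * x) = (1 / t) ^ b * Real.Gamma b := by
  rw [← Real.integral_rpow_mul_exp_neg_mul_Ioi hb ht, ml_int_exp]
  simp only [ml_rw]

lemma ml_intble_Ioi (t b : ℝ) (ht : 0 < t) :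
    IntegrableOn (fun x : ℝ => Real.exp (-(t * Real.exp x)) * Real.exp (b * x)) (Ioi 1) := by
  refine Integrable.mono' ((ml_intble t (max b 1) ht (by positivity)).integrableOn) 
    (by fun_prop) ?_
  rw [ae_restrict_iff' measurableSet_Ioi]
  refine Eventually.of_forall fun x hx => ?_
  have hx : 1 < x := hx
  rw [Real.norm_of_nonneg (by positivity)]
  gcongr
  exact le_max_left _ _

lemma ml_intble_Dl (t b : ℝ) (ht : 0 < t) : IntegrableOn (mlDl (mlg t b)) (Ioi 1) := by
  have : mlDl (mlg t b) = fun x => ((Real.exp (-(t * Real.exp x)) * Real.exp (b * x) * (2 * Real.sin (b * Real.pi)) : ℝ) : ℂ)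
      * Complex.I := funext (mlDl_g t b)
  rw [this]
  exact (((ml_intble_Ioi t b ht).mul_const _).ofReal).mul_const _

lemma ml_norm_g (t b x y : ℝ) (ht : 0 < t) :
    ‖mlg t b (x + y * Complex.I)‖ ≤ Real.exp (t * Real.exp x) * Real.exp (b * x) := by
  unfold mlg
  rw [norm_mul, ml_norm_exp]
  gcongr
  refine (Complex.norm_exp_le_exp_norm _).trans ?_
  rw [norm_mul, Complex.norm_exp]
  simp [abs_of_pos ht]

lemma mlJ_lt (t a : ℝ) (ht : 0 < t) (ha0 : 0 < a) (ha1 : a < 1) :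
    mlJ (mlg t (1 - a)) = 2 * Real.pi * Complex.I * ((t ^ (a - 1) / Real.Gamma a : ℝ) : ℂ) := by
  have hD : mlDl (mlg t (1-a)) = fun x => ((Real.exp (-(t * Real.exp x)) * Real.exp ((1-a) * x) * (2 * Real.sin ((1-a) * Real.pi)) : ℝ) : ℂ)
      * Complex.I := funext (mlDl_g t (1-a))
  rw [ml_strip (mlg t (1-a)) (fun w _ => by unfold mlg; fun_prop) (Real.exp t) (1 - a) 0 (by linarith)]
  · rw [hD, integral_mul_const, integral_complex_ofReal, integral_mul_const, ml_integral t _ ht (by linarith)]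
    have hs : 0 < Real.sin (Real.pi * a) := by
      apply Real.sin_pos_of_pos_of_lt_pi (by positivity)
      nlinarith [Real.pi_pos]
    have hG := Real.Gamma_mul_Gamma_one_sub a
    have hGa := Real.Gamma_pos_of_pos ha0
    have e1 : (1 - a) * Real.pi = Real.pi - Real.pi * a := by ring
    have e2 : (1 / t) ^ (1 - a) = t ^ (a - 1) := by
      rw [one_div, Real.inv_rpow ht.le, ← Real.rpow_neg ht.le]; congr 1; ring
    rw [e1, Real.sin_pi_sub, e2]
    have : t ^ (a - 1) * Real.Gamma (1 - a) * (2 * Real.sin (Real.pi * a))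
        = 2 * Real.pi * (t ^ (a - 1) / Real.Gamma a) := by
      rw [eq_div_iff hs.ne'] at hG
      field_simp
      rw [mul_comm a Real.pi]
      linear_combination hG
    rw [this]; push_cast; ring
  · intro x y hx _
    refine (ml_norm_g t _ x y ht).trans ?_
    gcongr
    have : Real.exp x ≤ 1 := Real.exp_le_one_iff.2 hx
    nlinarith
  · rw [hD]
    exact (((ml_intble t _ ht (by linarith)).mul_const _).ofReal).mul_const _

lemma mlJ_one (t : ℝ) : mlJ (mlg t 0) = 2 * Real.pi * Complex.I := by
  have hD : mlDl (mlg t 0) = fun x => 0 := by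
    funext x; rw [mlDl_g]; simp
  unfold mlJ
  rw [hD]
  have h := DiffContOnCl.circleAverage (f := fun z : ℂ => Complex.exp (t * z)) (c := 0) (R := Real.exp 1)
    (Differentiable.diffContOnCl (by fun_prop))
  rw [Real.circleAverage_def] at h
  have hp : Function.Periodic (fun θ : ℝ => Complex.exp (t * circleMap 0 (Real.exp 1) θ)) (2 * Real.pi) := by
    intro θ
    simp only [periodic_circleMap 0 (Real.exp 1) θ]
  have h2 := hp.intervalIntegral_add_eq (-Real.pi) 0
  have h3 : mlRR (mlg t 0) 1 = ∫ θ in (-Real.pi)..(-Real.pi + 2 * Real.pi), Complex.exp (t * circleMap 0 (Real.exp 1) θ) := by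
    unfold mlRR mlg
    rw [show -Real.pi + 2 * Real.pi = Real.pi by ring]
    apply intervalIntegral.integral_congr
    intro y _
    simp [circleMap, Complex.exp_add]
  rw [h3, h2, zero_add]
  have hpi : (Real.pi : ℂ) ≠ 0 := by exact_mod_cast Real.pi_ne_zero
  simp at h
  field_simp at h
  simp
  rw [h]; ring

lemma mlJ_rec (t a : ℝ) (ht : 0 < t) (ha0 : 0 < a) :
    t * mlJ (mlg t (1 - a)) = a * mlJ (mlg t (1 - (a + 1))) := by
  have hpi := Real.pi_pos
  have hder : ∀ w : ℂ, HasDerivAt (mlg t (-a)) (t * mlg t (1 - a) w - a * mlg t (1 - (a+1)) w) w := by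
    intro w
    unfold mlg
    have h1 : HasDerivAt (fun w : ℂ => Complex.exp (t * Complex.exp w)) 
      (Complex.exp (t * Complex.exp w) * (t * Complex.exp w)) w :=
      ((Complex.hasDerivAt_exp w).const_mul _).cexp
    have h2 : HasDerivAt (fun w : ℂ => Complex.exp ((-a : ℝ) * w)) 
      (Complex.exp ((-a : ℝ) * w) * ((-a : ℝ) * 1)) w :=
      ((hasDerivAt_id w).const_mul _).cexp
    refine (h1.mul h2).congr_deriv ?_
    have e1 : Complex.exp ((1 - a : ℝ) * w) = Complex.exp w * Complex.exp ((-a : ℝ) * w) := by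
      rw [← Complex.exp_add]; congr 1; push_cast; ring
    have e2 : (1 - (a + 1) : ℝ) = -a := by ring
    simp only [e1, e2]
    push_cast; ring
  have hgc : ∀ b, Continuous (mlg t b) := fun b => by unfold mlg; fun_prop
  -- segment
  have hR : Complex.I * (t * mlRR (mlg t (1 - a)) 1 - a * mlRR (mlg t (1 - (a+1))) 1)
      = mlDl (mlg t (-a)) 1 := by
    have hd : ∀ y : ℝ, HasDerivAt (fun y : ℝ => mlg t (-a) ((1:ℝ) + y * Complex.I))
        ((t * mlg t (1 - a) ((1:ℝ) + y * Complex.I) - a * mlg t (1 - (a+1)) ((1:ℝ) + y * Complex.I)) * Complex.I) y := by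
      intro y
      have h1 : HasDerivAt (fun y : ℂ => (1:ℝ) + y * Complex.I) Complex.I (y : ℂ) := by
        simpa using ((hasDerivAt_id (y : ℂ)).mul_const Complex.I).const_add ((1:ℝ) : ℂ)
      exact ((hder _).comp (y : ℂ) h1).comp_ofReal
    have := intervalIntegral.integral_eq_sub_of_hasDerivAt (a := -Real.pi) (b := Real.pi)
      (fun y _ => hd y) (Continuous.intervalIntegrable (by 
        have := hgc (1-a); have := hgc (1-(a+1)); fun_prop) _ _)
    unfold mlDl mlRR
    rw [← this, intervalIntegral.integral_mul_const, intervalIntegral.integral_sub, 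
      intervalIntegral.integral_const_mul, intervalIntegral.integral_const_mul]
    · ring
    · exact Continuous.intervalIntegrable (by have := hgc (1-a); fun_prop) _ _
    · exact Continuous.intervalIntegrable (by have := hgc (1-(a+1)); fun_prop) _ _
  have hI : (t * (∫ x in Ioi (1:ℝ), mlDl (mlg t (1-a)) x) - a * ∫ x in Ioi (1:ℝ), mlDl (mlg t (1-(a+1))) x)
      = - mlDl (mlg t (-a)) 1 := by
    have hd : ∀ (c x : ℝ), HasDerivAt (fun x : ℝ => mlg t (-a) (x + c * Complex.I))
        (t * mlg t (1 - a) (x + c * Complex.I) - a * mlg t (1 - (a+1)) (x + c * Complex.I)) x := by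
      intro c x
      have h1 : HasDerivAt (fun y : ℂ => y + c * Complex.I) 1 (x : ℂ) := by
        simpa using (hasDerivAt_id (x : ℂ)).add_const (c * Complex.I)
      simpa using ((hder _).comp (x : ℂ) h1).comp_ofReal
    have hd2 : ∀ x : ℝ, HasDerivAt (mlDl (mlg t (-a))) (t * mlDl (mlg t (1-a)) x - a * mlDl (mlg t (1-(a+1))) x) x := by
      intro x
      unfold mlDl
      refine ((hd Real.pi x).sub (hd (-Real.pi) x)).congr_deriv ?_
      ring
    have hi1 := (ml_intble_Dl t (1-a) ht).const_mul (t : ℂ)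
    have hi2 := (ml_intble_Dl t (1-(a+1)) ht).const_mul (a : ℂ)
    have := integral_Ioi_of_hasDerivAt_of_tendsto (a := (1:ℝ)) (m := 0) (hd2 1).continuousAt.continuousWithinAt
      (fun x _ => hd2 x) (hi1.sub hi2) (by
        have hE : Tendsto (fun x : ℝ => Real.exp (-a * x) * 2) atTop (nhds 0) := by
          have : Tendsto (fun x : ℝ => Real.exp (-a * x)) atTop (nhds 0) :=
            Real.tendsto_exp_atBot.comp (tendsto_id.const_mul_atTop_of_neg (by linarith))
          simpa using this.mul_const 2
        refine squeeze_zero_norm (fun x => ?_) hE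
        rw [mlDl_g, norm_mul, Complex.norm_I, mul_one, Complex.norm_real, norm_mul, norm_mul, norm_mul]
        simp only [Real.norm_eq_abs, Real.abs_exp, abs_two]
        have h1 : Real.exp (-(t * Real.exp x)) ≤ 1 := Real.exp_le_one_iff.2 (by
          have := Real.exp_pos x; nlinarith)
        have h2 := Real.abs_sin_le_one (-a * Real.pi)
        calc _ ≤ 1 * Real.exp (-a * x) * (2 * 1) := by gcongr
          _ = _ := by ring)
    rw [zero_sub] at this
    rw [← this, integral_sub hi1 hi2, integral_const_mul, integral_const_mul]
  unfold mlJ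
  linear_combination hR + hI

lemma mlJ_eq (t : ℝ) (ht : 0 < t) (n : ℕ) : ∀ a : ℝ, 0 < a → a ≤ n + 1 → 
    mlJ (mlg t (1 - a)) = 2 * Real.pi * Complex.I * ((t ^ (a - 1) / Real.Gamma a : ℝ) : ℂ) := by
  induction n with
  | zero =>
    intro a h0 h1
    simp at h1
    rcases h1.lt_or_eq with h | h
    · exact mlJ_lt t a ht h0 h
    · subst h; simp [mlJ_one]
  | succ n ih =>
    intro a h0 h1
    by_cases ha : a ≤ 1
    · exact ih a h0 (by have : (0:ℝ) ≤ n := by positivity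
                        linarith)
    · push Not at ha
      push_cast at h1
      have h2 := ih (a - 1) (by linarith) (by linarith)
      have h3 := mlJ_rec t (a - 1) ht (by linarith)
      rw [h2, sub_add_cancel] at h3
      have hG : Real.Gamma a = (a - 1) * Real.Gamma (a - 1) := by
        have := Real.Gamma_add_one (s := a - 1) (by linarith)
        simpa using this
      have ht' : t ^ (a - 1) = t ^ (a - 1 - 1) * t := by
        rw [Real.rpow_sub_one ht.ne' (a - 1)]; field_simp
      have hGp := Real.Gamma_pos_of_pos (s := a - 1) (by linarith)
      rw [hG, ht']
      have ha' : ((a - 1 : ℝ) : ℂ) ≠ 0 := by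
        exact_mod_cast (by linarith : a - 1 ≠ 0)
      apply mul_left_cancel₀ ha'
      rw [← h3]
      have : t ^ (a - 1 - 1) * t / ((a-1) * Real.Gamma (a-1)) = (t * (t ^ (a - 1 - 1) / Real.Gamma (a-1))) / (a-1) := by
        field_simp
      rw [this, Complex.ofReal_div _ (a - 1), Complex.ofReal_mul t]
      field_simp

/-- main function -/
noncomputable def mlq (β t : ℝ) (w : ℂ) : ℂ :=
  Complex.exp (t * Complex.exp w) * (Complex.exp (β * w) / (Complex.exp (β * w) + 1))

lemma mlq_ne (β : ℝ) (hβ : β ∈ Set.Ioo (0:ℝ) 1) (w : ℂ) (hw : |w.im| ≤ Real.pi) :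
    Complex.exp (β * w) + 1 ≠ 0 := by
  intro h
  have h1 : Complex.exp (β * w) = -1 := by linear_combination h
  have hpi := Real.pi_pos
  have him : ((β : ℂ) * w).im = β * w.im := by simp
  obtain ⟨ha, hb⟩ := abs_le.1 hw
  have l1 : -Real.pi < β * w.im := by nlinarith [hβ.1, hβ.2]
  have l2 : β * w.im < Real.pi := by nlinarith [hβ.1, hβ.2]
  have h2 := Complex.log_exp (x := β * w) (by rw [him]; exact l1) (by rw [him]; exact l2.le)
  rw [h1, Complex.log_neg_one] at h2
  have h3 := congrArg Complex.im h2
  rw [him] at h3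
  simp at h3
  linarith

lemma mlq_hasSum (β t : ℝ) (hβ : β ∈ Set.Ioo (0:ℝ) 1) (x y : ℝ) (hx : 1 ≤ x) :
    HasSum (fun n : ℕ => (-1 : ℂ) ^ n * mlg t (1 - (n * β + 1)) (x + y * Complex.I))
      (mlq β t (x + y * Complex.I)) := by
  set w : ℂ := x + y * Complex.I
  have hn : ‖-Complex.exp ((-β : ℝ) * w)‖ < 1 := by
    rw [norm_neg, ml_norm_exp, Real.exp_lt_one_iff]
    nlinarith [hβ.1]
  have h := (hasSum_geometric_of_norm_lt_one hn).mul_left (Complex.exp (t * Complex.exp w))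
  have hne : Complex.exp (β * w) + 1 ≠ 0 := by
    intro h
    have h1 : Complex.exp (β * w) = -1 := by linear_combination h
    have := ml_norm_exp β x y
    rw [h1] at this
    rw [norm_neg, norm_one] at this
    have h2 : 0 < β * x := mul_pos hβ.1 (by linarith)
    have h3 := Real.one_lt_exp_iff.2 h2
    linarith
  have e : Complex.exp ((-β : ℝ) * w) = (Complex.exp (β * w))⁻¹ := by
    rw [← Complex.exp_neg]; congr 1; push_cast; ring
  have k : ∀ {f f' : ℕ → ℂ} {a a' : ℂ}, HasSum f a → f' = f → a' = a → HasSum f' a' := by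
    intro f f' a a' h h1 h2
    rw [h1, h2]; exact h
  refine k h ?_ ?_
  · funext n
    unfold mlg
    rw [neg_pow (Complex.exp _), ← Complex.exp_nat_mul]
    have : ((1 - (n * β + 1) : ℝ) : ℂ) * w = n * ((-β : ℝ) * w) := by push_cast; ring
    rw [this]; ring
  · unfold mlq
    rw [e]
    have h0 := Complex.exp_ne_zero (β * w)
    congr 1
    rw [sub_neg_eq_add]
    have : 1 + (Complex.exp (β * w))⁻¹ ≠ 0 := by
      intro h'
      apply hne
      field_simp at h'
      simpa using h'
    field_simp

lemma ml_rpow_bd (β : ℝ) (hβ : 0 < β) (n : ℕ) (x : ℝ) (hx : 1 ≤ x) :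
    Real.exp ((1 - (n * β + 1)) * x) ≤ Real.exp (-β) ^ n := by
  rw [← Real.exp_nat_mul]
  apply Real.exp_le_exp.2
  have : (0:ℝ) ≤ n * β := by positivity
  nlinarith

lemma mlq_J (β t : ℝ) (hβ : β ∈ Set.Ioo (0:ℝ) 1) (ht : 0 < t) :
    HasSum (fun n : ℕ => (-1 : ℂ) ^ n * mlJ (mlg t (1 - (n * β + 1)))) (mlJ (mlq β t)) := by
  have hpi := Real.pi_pos
  have hr0 : 0 ≤ Real.exp (-β) := by positivity
  have hr : Real.exp (-β) < 1 := by rw [Real.exp_lt_one_iff]; linarith [hβ.1]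
  have hgc : ∀ b, Continuous (mlg t b) := fun b => by unfold mlg; fun_prop
  have hS : HasSum (fun n : ℕ => (-1 : ℂ) ^ n * mlRR (mlg t (1 - (n * β + 1))) 1) (mlRR (mlq β t) 1) := by
    have := intervalIntegral.hasSum_integral_of_dominated_convergence (μ := volume)
      (a := -Real.pi) (b := Real.pi)
      (F := fun (n : ℕ) (y : ℝ) => (-1 : ℂ) ^ n * mlg t (1 - (n * β + 1)) ((1:ℝ) + y * Complex.I))
      (f := fun y : ℝ => mlq β t ((1:ℝ) + y * Complex.I))
      (fun n _ => Real.exp (t * Real.exp 1) * Real.exp (-β) ^ n)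
      (fun n => by
        have := hgc (1 - (n * β + 1))
        exact Continuous.aestronglyMeasurable (by fun_prop))
      (fun n => Eventually.of_forall fun y _ => by
        rw [norm_mul, norm_pow, norm_neg, norm_one, one_pow, one_mul]
        refine (ml_norm_g t _ 1 y ht).trans ?_
        gcongr
        exact ml_rpow_bd β hβ.1 n 1 le_rfl)
      (Eventually.of_forall fun y _ => (summable_geometric_of_lt_one hr0 hr).mul_left _)
      (by simp)
      (Eventually.of_forall fun y _ => mlq_hasSum β t hβ 1 y le_rfl)
    simp only [intervalIntegral.integral_const_mul] at this
    exact this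
  have hI : HasSum (fun n : ℕ => (-1 : ℂ) ^ n * ∫ x in Ioi (1:ℝ), mlDl (mlg t (1 - (n * β + 1))) x)
      (∫ x in Ioi (1:ℝ), mlDl (mlq β t) x) := by
    have := hasSum_integral_of_dominated_convergence (μ := volume.restrict (Ioi (1:ℝ)))
      (F := fun (n : ℕ) (x : ℝ) => (-1 : ℂ) ^ n * mlDl (mlg t (1 - (n * β + 1))) x)
      (f := fun x : ℝ => mlDl (mlq β t) x)
      (fun n x => (Real.exp (-(t * Real.exp x)) * Real.exp (0 * x) * 2) * Real.exp (-β) ^ n)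
      (fun n => ((ml_intble_Dl t _ ht).const_mul _).aestronglyMeasurable)
      (fun n => by
        rw [ae_restrict_iff' measurableSet_Ioi]
        refine Eventually.of_forall fun x hx => ?_
        have hx : 1 < x := hx
        rw [norm_mul, norm_pow, norm_neg, norm_one, one_pow, one_mul]
        rw [mlDl_g, norm_mul, Complex.norm_I, mul_one, Complex.norm_real, norm_mul, norm_mul, norm_mul]
        simp only [Real.norm_eq_abs, Real.abs_exp, abs_two]
        have h2 := Real.abs_sin_le_one ((1 - (n * β + 1)) * Real.pi)
        have h3 := ml_rpow_bd β hβ.1 n x hx.le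
        calc _ ≤ Real.exp (-(t * Real.exp x)) * Real.exp (-β) ^ n * (2 * 1) := by gcongr
          _ = _ := by simp; ring)
      (Eventually.of_forall fun y => (summable_geometric_of_lt_one hr0 hr).mul_left _)
      (by
        simp only [tsum_mul_left]
        exact ((ml_intble_Ioi t 0 ht).mul_const 2).mul_const _)
      (by
        rw [ae_restrict_iff' measurableSet_Ioi]
        refine Eventually.of_forall fun x hx => ?_
        have hx : 1 < x := hx
        unfold mlDl
        simp only [mul_sub]
        exact (mlq_hasSum β t hβ x Real.pi hx.le).sub (mlq_hasSum β t hβ x (-Real.pi) hx.le))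
    simpa only [integral_const_mul] using this
  have hh := (hS.mul_left Complex.I).add hI
  have e : (fun n : ℕ => (-1 : ℂ) ^ n * mlJ (mlg t (1 - (n * β + 1)))) = fun n : ℕ =>
      Complex.I * ((-1 : ℂ) ^ n * mlRR (mlg t (1 - (n * β + 1))) 1) +
        (-1 : ℂ) ^ n * ∫ x in Ioi (1:ℝ), mlDl (mlg t (1 - (n * β + 1))) x := by
    funext n
    unfold mlJ
    ring
  rw [e]
  exact hh

lemma ml_den (β : ℝ) (hβ : β ∈ Set.Ioo (0:ℝ) 1) (u : ℝ) :
    Real.sin (β * Real.pi) ^ 2 ≤ u ^ 2 + 2 * u * Real.cos (β * Real.pi) + 1 := by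
  nlinarith [Real.sin_sq_add_cos_sq (β * Real.pi), sq_nonneg (u + Real.cos (β * Real.pi))]

lemma ml_sin (β : ℝ) (hβ : β ∈ Set.Ioo (0:ℝ) 1) : 0 < Real.sin (β * Real.pi) := by
  have hpi := Real.pi_pos
  apply Real.sin_pos_of_pos_of_lt_pi
  · have := hβ.1; positivity
  · nlinarith [hβ.2]

lemma mlDl_q (β t : ℝ) (hβ : β ∈ Set.Ioo (0:ℝ) 1) (x : ℝ) : mlDl (mlq β t) x =
    ((Real.exp x * (Real.exp (-(Real.exp x * t)) * Kspec β (Real.exp x)) : ℝ) : ℂ)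
      * (2 * Real.pi * Complex.I) := by
  have hpi := Real.pi_pos
  have hs := ml_sin β hβ
  have hden := ml_den β hβ (Real.exp (β * x))
  have hden' : 0 < Real.exp (β * x) ^ 2 + 2 * Real.exp (β * x) * Real.cos (β * Real.pi) + 1 :=
    lt_of_lt_of_le (by positivity) hden
  have n1 := mlq_ne β hβ (x + Real.pi * Complex.I) (by simp [abs_of_pos hpi])
  have n2 := mlq_ne β hβ (x + (-Real.pi : ℝ) * Complex.I) (by simp [abs_of_pos hpi])
  have hK : Real.exp x * (Real.exp (-(Real.exp x * t)) * Kspec β (Real.exp x)) * (2 * Real.pi)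
      = Real.exp (-(t * Real.exp x)) * (2 * Real.exp (β * x) * Real.sin (β * Real.pi)
        / (Real.exp (β * x) ^ 2 + 2 * Real.exp (β * x) * Real.cos (β * Real.pi) + 1)) := by
    unfold Kspec
    have e1 : Real.exp x ^ (β - 1) = Real.exp (β * x) / Real.exp x := by
      rw [← Real.exp_mul, ← Real.exp_sub]; congr 1; ring
    have e2 : Real.exp x ^ (2 * β) = Real.exp (β * x) ^ 2 := by
      rw [← Real.exp_mul, ← Real.exp_nat_mul]; congr 1; push_cast; ring
    have e3 : Real.exp x ^ β = Real.exp (β * x) := by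
      rw [← Real.exp_mul]; congr 1; ring
    rw [e1, e2, e3, mul_comm (Real.exp x) t]
    field_simp
  have hK' : ((Real.exp x * (Real.exp (-(Real.exp x * t)) * Kspec β (Real.exp x)) : ℝ) : ℂ)
      * (2 * Real.pi * Complex.I) = ((Real.exp x * (Real.exp (-(Real.exp x * t)) * Kspec β (Real.exp x)) * (2 * Real.pi) : ℝ) : ℂ) * Complex.I := by
    push_cast; ring
  rw [hK', hK]
  unfold mlDl mlq
  have a1 : (β : ℂ) * (x + Real.pi * Complex.I) = ((β * x : ℝ) : ℂ) + ((β * Real.pi : ℝ) : ℂ) * Complex.I := by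
    push_cast; ring
  have a2 : (β : ℂ) * (x + (-Real.pi : ℝ) * Complex.I) = ((β * x : ℝ) : ℂ) + ((-(β * Real.pi) : ℝ) : ℂ) * Complex.I := by
    push_cast; ring
  rw [a1, Complex.exp_add, Complex.exp_mul_I, ← Complex.ofReal_exp, ← Complex.ofReal_cos, ← Complex.ofReal_sin] at n1
  rw [a2, Complex.exp_add, Complex.exp_mul_I, ← Complex.ofReal_exp, ← Complex.ofReal_cos, ← Complex.ofReal_sin, Real.cos_neg, Real.sin_neg] at n2
  rw [ml_exp_pi, ml_exp_neg_pi, a1, a2, Complex.exp_add, Complex.exp_add, Complex.exp_mul_I, Complex.exp_mul_I,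
    ← Complex.ofReal_exp, ← Complex.ofReal_cos, ← Complex.ofReal_sin, ← Complex.ofReal_cos, ← Complex.ofReal_sin,
    Real.cos_neg, Real.sin_neg, ← mul_sub]
  have hsc := Real.sin_sq_add_cos_sq (β * Real.pi)
  have hE : Complex.exp ((t : ℂ) * ((-Real.exp x : ℝ) : ℂ)) = ((Real.exp (-(t * Real.exp x)) : ℝ) : ℂ) := by
    push_cast; congr 1; ring
  rw [hE, Complex.ofReal_mul, mul_assoc]
  congr 1
  generalize Real.exp (β * x) = u at *
  generalize Real.cos (β * Real.pi) = c at *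
  generalize Real.sin (β * Real.pi) = s at *
  have hsc' : (s : ℂ) ^ 2 + (c : ℂ) ^ 2 = 1 := by exact_mod_cast hsc
  have n3 : ((u : ℂ) ^ 2 + 2 * u * c + 1) ≠ 0 := by exact_mod_cast hden'.ne'
  push_cast at n1 n2 ⊢
  rw [div_sub_div _ _ n1 n2, div_mul_eq_mul_div, div_eq_div_iff (mul_ne_zero n1 n2) n3]
  have hprod : ((u : ℂ) * (c + s * Complex.I) + 1) * ((u : ℂ) * (c + -s * Complex.I) + 1) = (u : ℂ) ^ 2 + 2 * u * c + 1 := by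
    linear_combination (u:ℂ)^2 * hsc' - (u:ℂ)^2 * s^2 * Complex.I_sq
  rw [hprod]
  ring

lemma mlq_strip (β t : ℝ) (hβ : β ∈ Set.Ioo (0:ℝ) 1) (ht : 0 < t) :
    mlJ (mlq β t) = ∫ x, mlDl (mlq β t) x := by
  have hpi := Real.pi_pos
  have hs := ml_sin β hβ
  refine ml_strip (mlq β t) (fun w hw => ?_) (Real.exp t * 2) β (min 0 (Real.log (1/2) / β)) hβ.1 ?_ ?_
  · have := mlq_ne β hβ w hw
    unfold mlq
    fun_prop (disch := assumption)
  · intro x y hx hy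
    have hx0 : x ≤ 0 := hx.trans (min_le_left _ _)
    have hx1 : x ≤ Real.log (1/2) / β := hx.trans (min_le_right _ _)
    unfold mlq
    have hn := ml_norm_exp β x y
    have h1 : Real.exp (β * x) ≤ 1/2 := by
      rw [le_div_iff₀ hβ.1] at hx1
      rw [← Real.exp_log (show (0:ℝ) < 1/2 by norm_num)]
      apply Real.exp_le_exp.2; linarith
    have h2 : 1/2 ≤ ‖Complex.exp (β * (x + y * Complex.I)) + 1‖ := by
      have := norm_sub_norm_le (1:ℂ) (-Complex.exp (β * (x + y * Complex.I)))
      rw [norm_neg, hn, sub_neg_eq_add, norm_one, add_comm] at this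
      linarith
    have h3 := ml_norm_g t 0 x y ht
    simp [mlg] at h3
    rw [norm_mul, norm_div, hn, mul_assoc]
    apply mul_le_mul _ _ (by positivity) (by positivity)
    · rw [Complex.norm_exp]
      apply Real.exp_le_exp.2
      refine (Complex.re_le_norm _).trans ?_
      rw [norm_mul, Complex.norm_exp]
      have : Real.exp x ≤ 1 := Real.exp_le_one_iff.2 hx0
      simp [abs_of_pos ht]
      nlinarith
    · rw [div_le_iff₀ (by linarith)]
      nlinarith [Real.exp_pos (β * x)]
  · have hD : mlDl (mlq β t) = fun x => ((Real.exp x * (Real.exp (-(Real.exp x * t)) * Kspec β (Real.exp x)) : ℝ) : ℂ)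
      * (2 * Real.pi * Complex.I) := funext (mlDl_q β t hβ)
    rw [hD]
    refine (Integrable.ofReal ?_).mul_const _
    refine (ml_intble_exp (fun θ => Real.exp (-(θ * t)) * Kspec β θ)).1 ?_
    have hb := integrableOn_rpow_mul_exp_neg_mul_rpow (p := 1) (s := β - 1) (b := t) (by linarith [hβ.1])
      one_pos ht
    simp only [Real.rpow_one, neg_mul] at hb
    refine Integrable.mono' (hb.const_mul (1 / Real.pi * Real.sin (β * Real.pi) / Real.sin (β * Real.pi) ^ 2)) ?_ ?_
    · unfold Kspec
      exact Measurable.aestronglyMeasurable (by fun_prop)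
    · rw [ae_restrict_iff' measurableSet_Ioi]
      refine Eventually.of_forall fun θ hθ => ?_
      have hθ : 0 < θ := hθ
      have hden := ml_den β hβ (θ ^ β)
      have e2 : θ ^ (2 * β) = (θ ^ β) ^ 2 := by
        rw [← Real.rpow_natCast, ← Real.rpow_mul hθ.le]; congr 1; push_cast; ring
      have hden' := lt_of_lt_of_le (by positivity) hden
      unfold Kspec
      rw [e2, Real.norm_of_nonneg (by positivity)]
      calc _ ≤ Real.exp (-(θ * t)) * (1 / Real.pi * (θ ^ (β - 1) * Real.sin (β * Real.pi)) / Real.sin (β * Real.pi) ^ 2) := by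
            gcongr
        _ = _ := by rw [mul_comm θ t]; ring

/-- Spectral representation of the Mittag-Leffler survival function:
`E_β(-t^β) = ∫_0^∞ e^{-θt} K_β(θ) dθ` for `β ∈ (0,1)`, `t > 0`. -/
theorem mittagLeffler_spectral_rep (β : ℝ) (hβ : β ∈ Set.Ioo (0:ℝ) 1)
    (t : ℝ) (ht : 0 < t) :
    ML β (-(t ^ β)) = ∫ θ in Set.Ioi (0:ℝ), Real.exp (-(θ * t)) * Kspec β θ := by
  have hpi := Real.pi_pos
  have h := mlq_J β t hβ ht
  rw [mlq_strip β t hβ ht] at h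
  simp only [mlDl_q β t hβ] at h
  rw [integral_mul_const, integral_complex_ofReal, 
    ← ml_int_exp (fun θ => Real.exp (-(θ * t)) * Kspec β θ)] at h
  have hne : (2 * Real.pi * Complex.I : ℂ) ≠ 0 := by
    simp [Real.pi_ne_zero]
  have hJ : ∀ n : ℕ, (-1 : ℂ) ^ n * mlJ (mlg t (1 - (n * β + 1))) =
      (((-(t ^ β)) ^ n / Real.Gamma (n * β + 1) : ℝ) : ℂ) * (2 * Real.pi * Complex.I) := by
    intro n
    have hnb : (0:ℝ) ≤ n * β := mul_nonneg (by positivity) hβ.1.le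
    have hnn : (0:ℝ) ≤ n := by positivity
    rw [mlJ_eq t ht n _ (by linarith) (by nlinarith [hβ.2])]
    have : t ^ ((n : ℝ) * β + 1 - 1) = (t ^ β) ^ n := by
      rw [← Real.rpow_natCast, ← Real.rpow_mul ht.le]; congr 1; ring
    rw [this, neg_pow (t ^ β)]
    push_cast; ring
  simp only [hJ] at h
  rw [hasSum_mul_right_iff hne] at h
  have h' := Complex.hasSum_ofReal.1 h
  exact h'.tsum_eq
end

section
/- Let β ∈ (0,1). Then ∫_0^∞ K_β(θ) dθ = 1, where K_β(θ) = (1/π) · θ^{β-1} sin(βπ) / (θ^{2β} + 2 θ^β cos(βπ) + 1). -/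
open MeasureTheory Set Filter

/-- For `β ∈ (0,1)`, the spectral kernel integrates to one: `∫_0^∞ K_β(θ) dθ = 1`. -/
theorem spectral_kernel_integral_one (β : ℝ) (hβ : β ∈ Set.Ioo (0:ℝ) 1) :
    ∫ θ in Set.Ioi (0:ℝ), Kspec β θ = 1 := by
  obtain ⟨h0, h1⟩ := hβ
  have hpi := Real.pi_pos
  have hs : 0 < Real.sin (β * Real.pi) :=
    Real.sin_pos_of_pos_of_lt_pi (by positivity) (by nlinarith)
  have hsc := Real.sin_sq_add_cos_sq (β * Real.pi)
  have hat : Real.arctan (Real.cos (β * Real.pi) / Real.sin (β * Real.pi))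
      = Real.pi / 2 - β * Real.pi := by
    rw [← Real.sin_pi_div_two_sub (β * Real.pi), ← Real.cos_pi_div_two_sub (β * Real.pi), ← Real.tan_eq_sin_div_cos]
    exact Real.arctan_tan (by nlinarith) (by nlinarith)
  have key := integral_Ioi_of_hasDerivAt_of_nonneg (a := 0) (l := 1 / (Real.pi * β) * (Real.pi / 2))
    (g := fun θ : ℝ => 1 / (Real.pi * β) *
      Real.arctan ((θ ^ β + Real.cos (β * Real.pi)) / Real.sin (β * Real.pi)))
    (g' := Kspec β) ?_ ?_ ?_ ?_
  · rw [key]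
    simp only [Real.zero_rpow h0.ne', zero_add, hat]
    field_simp
    ring
  · apply Continuous.continuousWithinAt
    have := Real.continuous_rpow_const h0.le
    fun_prop
  · intro x hx
    have hx : 0 < x := hx
    have h := (((((Real.hasDerivAt_rpow_const (p := β) (Or.inl hx.ne')).add_const
      (Real.cos (β * Real.pi))).div_const (Real.sin (β * Real.pi))).arctan).const_mul
        (1 / (Real.pi * β)))
    refine h.congr_deriv ?_
    unfold Kspec
    rw [mul_comm 2 β, Real.rpow_mul hx.le, Real.rpow_two]
    have hc2 : Real.cos (β * Real.pi) ^ 2 = 1 - Real.sin (β * Real.pi) ^ 2 := by linarith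
    generalize x ^ β = u
    generalize Real.cos (β * Real.pi) = c at *
    generalize Real.sin (β * Real.pi) = s at *
    have hD : 0 < u ^ 2 + 2 * u * c + 1 := by nlinarith [sq_nonneg (u + c), pow_pos hs 2]
    have e : 1 + ((u + c) / s) ^ 2 = (u ^ 2 + 2 * u * c + 1) / s ^ 2 := by
      field_simp
      linear_combination hsc
    rw [e]
    field_simp
  · intro x hx
    have hx : 0 < x := hx
    unfold Kspec
    rw [mul_comm 2 β, Real.rpow_mul hx.le, Real.rpow_two]
    have : 0 < (x ^ β) ^ 2 + 2 * x ^ β * Real.cos (β * Real.pi) + 1 := by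
      nlinarith [sq_nonneg (x ^ β + Real.cos (β * Real.pi)), pow_pos hs 2]
    positivity
  · refine Tendsto.const_mul _ ?_
    refine (tendsto_nhds_of_tendsto_nhdsWithin Real.tendsto_arctan_atTop).comp ?_
    exact (tendsto_atTop_add_const_right _ _ (tendsto_rpow_atTop h0)).atTop_div_const hs
end

section
/- Let β ∈ (0,1]. For every t ≥ 0, the Mittag-Leffler survival function satisfies E_β(-t^β) = ∫_t^∞ f_β(u) du, where f_β(u) = u^{β-1} E_{β,β}(-u^β); that is, E_β(-t^β) is the survival function of a positive random variable with density f_β. -/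
open MeasureTheory Set Filter

lemma beta_aux (a b t : ℝ) (ha : 0 < a) (hb : 0 < b) (ht : 0 < t) :
    ∫ s in (0:ℝ)..t, (t - s) ^ (a - 1) * s ^ (b - 1)
      = t ^ (b + a - 1) * (Real.Gamma b * Real.Gamma a / Real.Gamma (b + a)) := by
  have h := Complex.betaIntegral_scaled (b : ℂ) (a : ℂ) ht
  rw [Complex.betaIntegral_eq_Gamma_mul_div _ _ (by simpa) (by simpa)] at h
  have h2 : ∫ x in (0:ℝ)..t, (x : ℂ) ^ ((b:ℂ) - 1) * ((t : ℂ) - x) ^ ((a:ℂ) - 1)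
      = ∫ x in (0:ℝ)..t, (((t - x) ^ (a - 1) * x ^ (b - 1) : ℝ) : ℂ) := by
    apply intervalIntegral.integral_congr
    intro x hx
    rw [uIcc_of_le ht.le] at hx
    simp only
    push_cast
    rw [Complex.ofReal_cpow (by linarith [hx.2]), Complex.ofReal_cpow hx.1]
    push_cast
    ring
  rw [h2, intervalIntegral.integral_ofReal] at h
  apply Complex.ofReal_injective
  rw [h]
  push_cast
  rw [Complex.ofReal_cpow ht.le]
  simp only [← Complex.Gamma_ofReal]
  push_cast
  rfl

lemma beta_pos_aux (a b t : ℝ) (ha : 0 < a) (hb : 0 < b) (ht : 0 < t) :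
    IntervalIntegrable (fun s => (t - s) ^ (a - 1) * s ^ (b - 1)) volume 0 t := by
  by_contra h
  have h1 := intervalIntegral.integral_undef h
  rw [beta_aux a b t ha hb ht] at h1
  have := Real.Gamma_pos_of_pos ha
  have := Real.Gamma_pos_of_pos hb
  have := Real.Gamma_pos_of_pos (add_pos hb ha)
  have : 0 < t ^ (b + a - 1) * (Real.Gamma b * Real.Gamma a / Real.Gamma (b + a)) := by positivity
  linarith

lemma gamma_lower_s9 (M x : ℝ) (hM : 0 < M) (hx : 1 ≤ x) :
    M ^ (x - 1) * Real.exp (-(M+1)) ≤ Real.Gamma x := by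
  rw [Real.Gamma_eq_integral (by linarith)]
  have hi := Real.GammaIntegral_convergent (s := x) (by linarith)
  have h1 : ∫ s in Ioc M (M+1), M ^ (x - 1) * Real.exp (-(M+1)) ≤
      ∫ s in Ioc M (M+1), Real.exp (-s) * s ^ (x - 1) := by
    apply setIntegral_mono_on
    · exact integrableOn_const (by simp)
    · exact hi.mono_set (fun y hy => hM.trans hy.1)
    · exact measurableSet_Ioc
    · intro s hs
      rw [mul_comm]
      apply mul_le_mul
      · apply Real.exp_le_exp.2; linarith [hs.2]
      · exact Real.rpow_le_rpow hM.le hs.1.le (by linarith)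
      · positivity
      · positivity
  have h2 : ∫ s in Ioc M (M+1), Real.exp (-s) * s ^ (x - 1) ≤
     ∫ s in Ioi 0, Real.exp (-s) * s ^ (x - 1) := by
    apply setIntegral_mono_set hi
    · refine (ae_restrict_iff' measurableSet_Ioi).2 (ae_of_all _ fun s hs => ?_)
      have : (0:ℝ) < s := hs
      simp only [Pi.zero_apply]; positivity
    · exact HasSubset.Subset.eventuallyLE (show Ioc M (M+1) ⊆ Ioi 0 from fun y hy => hM.trans hy.1)
  refine le_trans ?_ (h1.trans h2)
  simp

lemma summable_ML (β δ R : ℝ) (hβ : 0 < β) (hR : 0 < R) :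
    Summable (fun n : ℕ => R ^ n / Real.Gamma (n * β + δ)) := by
  set M : ℝ := (2 * R) ^ (1 / β) with hMdef
  have hM : 0 < M := by positivity
  have hMb : M ^ β = 2 * R := by
    rw [hMdef, ← Real.rpow_mul (by positivity)]; field_simp; simp
  have hs : Summable (fun n : ℕ => (M ^ (1 - δ) * Real.exp (M + 1)) * (1/2 : ℝ) ^ n) :=
    (summable_geometric_two).mul_left _
  refine Summable.of_norm_bounded_eventually_nat hs ?_
  obtain ⟨N, hN⟩ := exists_nat_ge ((1 - δ) / β)
  filter_upwards [eventually_ge_atTop N] with n hn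
  have hx : 1 ≤ n * β + δ := by
    have : (1 - δ) / β ≤ n := hN.trans (by exact_mod_cast hn)
    rw [div_le_iff₀ hβ] at this; linarith
  have hG := gamma_lower_s9 M _ hM hx
  have hGp := Real.Gamma_pos_of_pos (by linarith : 0 < n * β + δ)
  rw [Real.norm_of_nonneg (by positivity), div_le_iff₀ hGp]
  refine le_trans (le_of_eq ?_) (mul_le_mul_of_nonneg_left hG (by positivity))
  have e1 : M ^ (n * β + δ - 1) = (2 * R) ^ n * M ^ (δ - 1) := by
    rw [show n * β + δ - 1 = β * n + (δ - 1) by ring, Real.rpow_add hM, Real.rpow_mul hM.le, hMb,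
      Real.rpow_natCast]
  rw [e1, Real.exp_neg, show (1 - δ) = -(δ - 1) by ring, Real.rpow_neg hM.le, mul_pow]
  have : 0 < M ^ (δ - 1) := by positivity
  have := Real.exp_pos (M + 1)
  field_simp
  rw [← mul_pow]; norm_num

lemma summable_ML' (β δ z : ℝ) (hβ : 0 < β) :
    Summable (fun n : ℕ => z ^ n / Real.Gamma (n * β + δ)) := by
  have := (summable_ML β δ (|z| + 1) hβ (by positivity)).norm
  refine Summable.of_norm_bounded this fun n => ?_
  rw [norm_div, norm_div]
  gcongr
  rw [norm_pow, norm_pow]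
  gcongr
  simp only [Real.norm_eq_abs]
  exact (by linarith : |z| ≤ |z| + 1).trans (le_abs_self _)

lemma continuous_ML2 (β δ : ℝ) (hβ : 0 < β) : Continuous (ML2 β δ) := by
  rw [← continuousOn_univ]
  rw [continuousOn_univ, continuous_iff_continuousAt]
  intro z
  have hc : ContinuousOn (ML2 β δ) (Metric.ball 0 (|z| + 1)) := by
    unfold ML2
    refine continuousOn_tsum (u := fun n : ℕ => ‖(|z| + 1) ^ n / Real.Gamma (n * β + δ)‖)
      (fun n => by fun_prop) (summable_ML β δ (|z| + 1) hβ (by positivity)).norm ?_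
    intro n x hx
    rw [norm_div, norm_div, norm_pow, norm_pow]
    rw [mem_ball_zero_iff] at hx
    gcongr
    exact hx.le.trans (le_abs_self _)
  refine hc.continuousAt (Metric.isOpen_ball.mem_nhds ?_)
  rw [mem_ball_zero_iff]; simp

noncomputable def HML (β δ t : ℝ) : ℝ := t ^ (δ - 1) * ML2 β δ (-(t ^ β))

lemma continuous_phi (β δ : ℝ) (hβ : 0 < β) : Continuous (fun t : ℝ => ML2 β δ (-(t ^ β))) := by
  apply (continuous_ML2 β δ hβ).comp
  exact (Real.continuous_rpow_const hβ.le).neg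

lemma HML_rec (β δ t : ℝ) (hβ : 0 < β) (ht : 0 < t) :
    HML β δ t = t ^ (δ - 1) / Real.Gamma δ - HML β (δ + β) t := by
  unfold HML
  have h1 : ML2 β δ (-(t ^ β)) = 1 / Real.Gamma δ + (-(t^β)) * ML2 β (δ + β) (-(t ^ β)) := by
    unfold ML2
    rw [(summable_ML' β δ _ hβ).tsum_eq_zero_add, ← tsum_mul_left]
    congr 1
    · simp
    · congr 1; ext n; push_cast
      rw [show ((n:ℝ) + 1) * β + δ = n * β + (δ + β) by ring]; ring
  rw [h1, show δ + β - 1 = (δ - 1) + β by ring, Real.rpow_add ht]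
  ring

lemma conv_integrable (β a δ t : ℝ) (hβ : 0 < β) (ha : 0 < a) (hδ : 0 < δ) (ht : 0 < t) :
    IntervalIntegrable (fun s => (t - s) ^ (a - 1) * HML β δ s) volume 0 t := by
  have := (beta_pos_aux a δ t ha hδ ht).mul_continuousOn (continuous_phi β δ hβ).continuousOn
  refine this.congr ?_
  intro s _
  simp only [HML]; ring

lemma conv_HML (β a δ t : ℝ) (hβ : 0 < β) (ha : 0 < a) (hδ : 0 < δ) (ht : 0 < t) :
    ∫ s in (0:ℝ)..t, (t - s) ^ (a - 1) * HML β δ s = Real.Gamma a * HML β (δ + a) t := by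
  have hGa := Real.Gamma_pos_of_pos ha
  let F : ℕ → ℝ → ℝ := fun n s =>
    ((-1) ^ n / Real.Gamma (n * β + δ)) * ((t - s) ^ (a - 1) * s ^ (n * β + δ - 1))
  have hpos : ∀ n : ℕ, 0 < n * β + δ := fun n => by positivity
  have hFi : ∀ n, Integrable (F n) (volume.restrict (Ioc 0 t)) := by
    intro n
    have := (beta_pos_aux a _ t ha (hpos n) ht).const_mul ((-1) ^ n / Real.Gamma (n * β + δ))
    exact (intervalIntegrable_iff_integrableOn_Ioc_of_le ht.le).1 this
  have hint : ∀ n : ℕ, ∫ s in Ioc 0 t, ((t - s) ^ (a - 1) * s ^ (n * β + δ - 1)) =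
     Real.Gamma a * Real.Gamma (n * β + δ) *
       (t ^ (δ + a - 1) * ((t ^ β) ^ n / Real.Gamma (n * β + (δ + a)))) := by
    intro n
    rw [← intervalIntegral.integral_of_le ht.le, beta_aux a _ t ha (hpos n) ht]
    rw [show n * β + δ + a - 1 = β * n + (δ + a - 1) by ring, Real.rpow_add ht,
      Real.rpow_mul ht.le, Real.rpow_natCast, add_assoc]
    ring
  have hnorm : ∀ n, ∫ s in Ioc 0 t, ‖F n s‖ =
      Real.Gamma a * t ^ (δ + a - 1) * ((t ^ β) ^ n / Real.Gamma (n * β + (δ + a))) := by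
    intro n
    have hG := Real.Gamma_pos_of_pos (hpos n)
    have : ∫ s in Ioc 0 t, ‖F n s‖ = ∫ s in Ioc 0 t,
        (1 / Real.Gamma (n * β + δ)) * ((t - s) ^ (a - 1) * s ^ (n * β + δ - 1)) := by
      apply setIntegral_congr_fun measurableSet_Ioc
      intro s hs
      have h1 : 0 ≤ (t - s) ^ (a - 1) := Real.rpow_nonneg (by linarith [hs.2]) _
      have h2 : 0 ≤ s ^ (n * β + δ - 1) := Real.rpow_nonneg hs.1.le _
      simp only [F, norm_mul, norm_div, norm_pow, norm_neg, norm_one, one_pow]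
      rw [Real.norm_of_nonneg hG.le, Real.norm_of_nonneg h1, Real.norm_of_nonneg h2]
    rw [this, integral_const_mul, hint]
    field_simp
  have hsum : Summable fun n => ∫ s in Ioc 0 t, ‖F n s‖ := by
    simp_rw [hnorm]
    exact (summable_ML' β (δ + a) (t ^ β) hβ).mul_left _
  have key := hasSum_integral_of_summable_integral_norm hFi hsum
  rw [intervalIntegral.integral_of_le ht.le]
  have e1 : ∫ s in Ioc 0 t, (t - s) ^ (a - 1) * HML β δ s = ∫ s in Ioc 0 t, ∑' n, F n s := by
    apply setIntegral_congr_fun measurableSet_Ioc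
    intro s hs
    simp only [HML, ML2, F]
    rw [← tsum_mul_left, ← tsum_mul_left]
    congr 1; ext n
    rw [show n * β + δ - 1 = β * n + (δ - 1) by ring, Real.rpow_add hs.1,
      Real.rpow_mul hs.1.le, Real.rpow_natCast, neg_pow]
    ring
  rw [e1, ← key.tsum_eq]
  simp only [HML, ML2]
  rw [← tsum_mul_left, ← tsum_mul_left]
  congr 1; ext n
  have hG := Real.Gamma_pos_of_pos (hpos n)
  simp only [F]
  rw [integral_const_mul, hint, neg_pow (t ^ β) n]
  field_simp

lemma int_kernel (β t0 T : ℝ) (hβ : 0 < β) (h : t0 ≤ T) :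
    ∫ s in t0..T, (T - s) ^ (β - 1) = (T - t0) ^ β / β := by
  rw [intervalIntegral.integral_comp_sub_left (fun x : ℝ => x ^ (β - 1)) T, sub_self,
    integral_rpow (Or.inl (by linarith))]
  rw [sub_add_cancel, Real.zero_rpow hβ.ne', sub_zero]

lemma int_kernel_integrable (β t0 T : ℝ) (hβ : 0 < β) :
    IntervalIntegrable (fun s => (T - s) ^ (β - 1)) volume t0 T := by
  have := (intervalIntegral.intervalIntegrable_rpow' (a := T - t0) (b := 0)
    (r := β - 1) (by linarith)).comp_sub_left T
  simpa using this

lemma HML_pos (β δ : ℝ) (hβ : 0 < β) (hβ1 : β ≤ 1) (hδ : β ≤ δ) (x : ℝ) (hx : 0 < x) :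
    0 < HML β δ x := by
  have hδ0 : 0 < δ := hβ.trans_le hδ
  have hGβ := Real.Gamma_pos_of_pos hβ
  have hGδ := Real.Gamma_pos_of_pos hδ0
  have hφc := continuous_phi β δ hβ
  set φ : ℝ → ℝ := fun t => ML2 β δ (-(t ^ β)) with hφ
  have hHφ : ∀ t, HML β δ t = t ^ (δ - 1) * φ t := fun t => rfl
  have hφ0 : 0 < φ 0 := by
    have : φ 0 = 1 / Real.Gamma δ := by
      simp only [hφ, ML2, Real.zero_rpow hβ.ne', neg_zero]
      rw [tsum_eq_single 0]
      · simp
      · intro n hn; simp [hn]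
    rw [this]; positivity
  by_contra hcon
  have hφx : φ x ≤ 0 := by
    by_contra h; push Not at h
    exact hcon (by rw [hHφ]; positivity)
  let S : Set ℝ := Ici 0 ∩ φ ⁻¹' Iic 0
  have hSc : IsClosed S := isClosed_Ici.inter (isClosed_Iic.preimage hφc)
  have hSb : BddBelow S := ⟨0, fun y hy => hy.1⟩
  have hSn : S.Nonempty := ⟨x, hx.le, hφx⟩
  obtain ⟨T, hT⟩ : ∃ T, T = sInf S := ⟨_, rfl⟩
  have hTS : T ∈ S := hT ▸ hSc.csInf_mem hSn hSb
  have hT0 : 0 < T := by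
    rcases lt_or_eq_of_le (show 0 ≤ T from hTS.1) with h | h
    · exact h
    · have : φ T ≤ 0 := hTS.2
      rw [← h] at this; linarith
  have hlt : ∀ s, 0 ≤ s → s < T → 0 < φ s := by
    intro s hs hsT
    by_contra h; push Not at h
    have : T ≤ s := hT ▸ csInf_le hSb ⟨hs, h⟩
    linarith
  have hHlt : ∀ s, 0 < s → s < T → 0 < HML β δ s := fun s hs hsT => by
    have := hlt s hs.le hsT
    rw [hHφ]; positivity
  have hHT : HML β δ T ≤ 0 := by
    have h1 : φ T ≤ 0 := hTS.2
    have h2 : 0 < T ^ (δ - 1) := by positivity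
    rw [hHφ]; exact mul_nonpos_of_nonneg_of_nonpos h2.le h1
  -- choose t0
  obtain ⟨t0, ht0a, ht0b, ht0c⟩ : ∃ t0, T / 2 ≤ t0 ∧ t0 < T ∧
      (T - t0) ^ β < β * Real.Gamma β / 2 := by
    have hc : Tendsto (fun s : ℝ => (T - s) ^ β) (nhdsWithin T (Iio T)) (nhds 0) := by
      have : Continuous (fun s : ℝ => (T - s) ^ β) :=
        (Real.continuous_rpow_const hβ.le).comp (by fun_prop)
      have h := this.tendsto T
      simp only [sub_self, Real.zero_rpow hβ.ne'] at h
      exact h.mono_left nhdsWithin_le_nhds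
    have e1 := hc.eventually (gt_mem_nhds (show (0:ℝ) < β * Real.Gamma β / 2 by positivity))
    have e2 : ∀ᶠ s in nhdsWithin T (Iio T), T / 2 < s :=
      nhdsWithin_le_nhds (lt_mem_nhds (by linarith))
    obtain ⟨s, ⟨h1, h2⟩, h3⟩ := ((e1.and e2).and self_mem_nhdsWithin).exists
    exact ⟨s, h2.le, h3, h1⟩
  have ht00 : 0 < t0 := by linarith
  have hHc : ContinuousOn (HML β δ) (Icc t0 T) := by
    have : ContinuousOn (fun t => t ^ (δ - 1) * φ t) (Icc t0 T) := by
      apply ContinuousOn.mul _ hφc.continuousOn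
      intro s hs
      exact (Real.continuousAt_rpow_const _ _ (Or.inl (by linarith [hs.1]))).continuousWithinAt
    exact this
  obtain ⟨t1, ht1, hmax⟩ := isCompact_Icc.exists_isMaxOn (nonempty_Icc.2 ht0b.le) hHc
  have hH1 : 0 < HML β δ t1 :=
    (hHlt t0 ht00 ht0b).trans_le (hmax (left_mem_Icc.2 ht0b.le))
  have ht1T : t1 < T := by
    rcases lt_or_eq_of_le ht1.2 with h | h
    · exact h
    · rw [h] at hH1; linarith
  have ht10 : 0 < t1 := ht00.trans_le ht1.1
  have I := conv_integrable β β δ T hβ hβ hδ0 hT0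
  have I1 : IntervalIntegrable (fun s => (T - s) ^ (β - 1) * HML β δ s) volume 0 t1 :=
    I.mono_set (by rw [uIcc_of_le ht10.le, uIcc_of_le hT0.le]; exact Icc_subset_Icc_right ht1T.le)
  have I2 : IntervalIntegrable (fun s => (T - s) ^ (β - 1) * HML β δ s) volume t1 T :=
    I.mono_set (by rw [uIcc_of_le ht1T.le, uIcc_of_le hT0.le]; exact Icc_subset_Icc_left ht10.le)
  have I3 := conv_integrable β β δ t1 hβ hβ hδ0 ht10
  have E := conv_HML β β δ T hβ hβ hδ0 hT0
  have E1 := conv_HML β β δ t1 hβ hβ hδ0 ht10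
  rw [← intervalIntegral.integral_add_adjacent_intervals I1 I2] at E
  have R := HML_rec β δ T hβ hT0
  have R1 := HML_rec β δ t1 hβ ht10
  obtain ⟨q, hq⟩ : ∃ q, q = (T / t1) ^ (δ - 1) := ⟨_, rfl⟩
  have hqT : T ^ (δ - 1) = q * t1 ^ (δ - 1) := by
    rw [hq, Real.div_rpow hT0.le ht10.le]
    have : 0 < t1 ^ (δ - 1) := by positivity
    field_simp
  have hTt : 1 ≤ T / t1 := by rw [le_div_iff₀ ht10]; linarith
  have hq2 : 1 / 2 ≤ q := by
    have : (T / t1) ^ (-1 : ℝ) ≤ q := hq ▸ Real.rpow_le_rpow_of_exponent_le hTt (by linarith)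
    refine le_trans ?_ this
    rw [Real.rpow_neg_one, inv_div, le_div_iff₀ hT0]
    linarith [ht1.1]
  have B1 : ∫ s in (0:ℝ)..t1, (T - s) ^ (β - 1) * HML β δ s ≤
      ∫ s in (0:ℝ)..t1, q * ((t1 - s) ^ (β - 1) * HML β δ s) := by
    apply intervalIntegral.integral_mono_on_of_le_Ioo ht10.le I1 (I3.const_mul q)
    intro s hs
    rw [← mul_assoc]
    apply mul_le_mul_of_nonneg_right _ (hHlt s hs.1 (hs.2.trans ht1T)).le
    have h1 : 0 < t1 - s := by linarith [hs.2]
    have h2 : 0 < T - s := by linarith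
    have h3 : (T / t1) ≤ (T - s) / (t1 - s) := by
      rw [div_le_div_iff₀ ht10 h1]
      nlinarith [hs.1]
    have h4 : ((T - s) / (t1 - s)) ^ (β - 1) ≤ q := by
      refine (Real.rpow_le_rpow_of_nonpos (by positivity) h3 (by linarith)).trans ?_
      rw [hq]
      exact Real.rpow_le_rpow_of_exponent_le hTt (by linarith)
    rw [Real.div_rpow h2.le h1.le, div_le_iff₀ (by positivity)] at h4
    exact h4
  rw [intervalIntegral.integral_const_mul, E1] at B1
  have B2 : ∫ s in t1..T, (T - s) ^ (β - 1) * HML β δ s ≤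
      ∫ s in t1..T, (T - s) ^ (β - 1) * HML β δ t1 := by
    apply intervalIntegral.integral_mono_on_of_le_Ioo ht1T.le I2
      ((int_kernel_integrable β t1 T hβ).mul_const _)
    intro s hs
    apply mul_le_mul_of_nonneg_left _ (Real.rpow_nonneg (by linarith [hs.2]) _)
    exact hmax ⟨ht1.1.trans hs.1.le, hs.2.le⟩
  rw [intervalIntegral.integral_mul_const, int_kernel β t1 T hβ ht1T.le] at B2
  have B3 : (T - t1) ^ β / β < Real.Gamma β / 2 := by
    rw [div_lt_iff₀ hβ]
    have : (T - t1) ^ β ≤ (T - t0) ^ β :=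
      Real.rpow_le_rpow (by linarith) (by linarith [ht1.1]) hβ.le
    linarith
  have B4 := mul_lt_mul_of_pos_right B3 hH1
  have C : Real.Gamma β * HML β (δ + β) T < Real.Gamma β * (q * HML β (δ + β) t1 + q * HML β δ t1) := by
    have := mul_le_mul_of_nonneg_left (mul_le_mul_of_nonneg_right hq2 hH1.le) hGβ.le
    nlinarith
  have C2 := lt_of_mul_lt_mul_left C hGβ.le
  have C3 : T ^ (δ - 1) / Real.Gamma δ = q * (t1 ^ (δ - 1) / Real.Gamma δ) := by rw [hqT]; ring
  have C4 : t1 ^ (δ - 1) / Real.Gamma δ = HML β δ t1 + HML β (δ + β) t1 := by linarith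
  rw [C4] at C3
  linarith

/-- For `β ∈ (0,1]` and `t ≥ 0`, `E_β(-t^β) = ∫_t^∞ f_β(u) du`:
the Mittag-Leffler function is the survival function of the density `f_β`. -/
theorem mittagLeffler_survival_eq_integral (β : ℝ) (hβ : β ∈ Set.Ioc (0:ℝ) 1)
    (t : ℝ) (ht : 0 ≤ t) :
    ML β (-(t ^ β)) = ∫ u in Set.Ioi t, fML β u := by
  obtain ⟨hb, hb1⟩ := hβ
  have hf : ∀ u, fML β u = HML β β u := fun u => rfl
  have hg : ∀ u, ML β (-(u ^ β)) = HML β 1 u := fun u => by simp [HML, ML]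
  have hGβ := Real.Gamma_pos_of_pos hb
  have hint : ∀ T, 0 ≤ T → IntervalIntegrable (fML β) volume 0 T := by
    intro T hT
    rcases eq_or_lt_of_le hT with h | h
    · rw [← h]
    · have := conv_integrable β 1 β T hb one_pos hb h
      simpa [← hf] using this
  have hg0 : ML β (-((0:ℝ) ^ β)) = 1 := by
    simp only [ML, ML2, Real.zero_rpow hb.ne', neg_zero]
    rw [tsum_eq_single 0]
    · simp
    · intro n hn; simp [hn]
  have hF : ∀ T, 0 ≤ T → ∫ u in (0:ℝ)..T, fML β u = 1 - ML β (-(T ^ β)) := by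
    intro T hT
    rcases eq_or_lt_of_le hT with h | h
    · rw [← h, hg0]; simp
    · have h1 := conv_HML β 1 β T hb one_pos hb h
      have h2 := HML_rec β 1 T hb h
      simp only [sub_self, Real.rpow_zero, one_mul, Real.Gamma_one, div_one] at h1 h2
      rw [hg, h2, add_comm 1 β]
      simp only [hf, h1]; ring
  have hfpos : ∀ u, 0 < u → 0 < fML β u := fun u hu => HML_pos β β hb hb1 le_rfl u hu
  have hgpos : ∀ u, 0 < u → 0 < ML β (-(u ^ β)) := fun u hu => by
    rw [hg]; exact HML_pos β 1 hb hb1 hb1 u hu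
  have hint2 : ∀ a b, 0 ≤ a → a ≤ b → IntervalIntegrable (fML β) volume a b := fun a b ha hab =>
    (hint a ha).symm.trans (hint b (ha.trans hab))
  have hF2 : ∀ a b, 0 ≤ a → a ≤ b →
      ∫ u in a..b, fML β u = ML β (-(a ^ β)) - ML β (-(b ^ β)) := by
    intro a b ha hab
    have := intervalIntegral.integral_add_adjacent_intervals (hint a ha) (hint2 a b ha hab)
    rw [hF a ha, hF b (ha.trans hab)] at this
    linarith
  have hanti : ∀ a b, 0 ≤ a → a ≤ b → ML β (-(b ^ β)) ≤ ML β (-(a ^ β)) := by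
    intro a b ha hab
    have h1 := hF2 a b ha hab
    have : 0 ≤ ∫ u in a..b, fML β u := by
      rw [intervalIntegral.integral_of_le hab]
      exact setIntegral_nonneg measurableSet_Ioc fun u hu => (hfpos u (ha.trans_lt hu.1)).le
    linarith
  have hbd : ∀ T, 0 < T → ML β (-(T ^ β)) ≤ (β * Real.Gamma β) / T ^ β := by
    intro T hT
    have E := conv_HML β β 1 T hb hb one_pos hT
    have R := HML_rec β 1 T hb hT
    simp only [sub_self, Real.rpow_zero, Real.Gamma_one, div_one] at R
    have B : ∫ s in (0:ℝ)..T, (T - s) ^ (β - 1) * HML β 1 T ≤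
        ∫ s in (0:ℝ)..T, (T - s) ^ (β - 1) * HML β 1 s := by
      apply intervalIntegral.integral_mono_on_of_le_Ioo hT.le
        ((int_kernel_integrable β 0 T hb).mul_const _) (conv_integrable β β 1 T hb hb one_pos hT)
      intro s hs
      apply mul_le_mul_of_nonneg_left _ (Real.rpow_nonneg (by linarith [hs.2]) _)
      rw [← hg, ← hg]
      exact hanti s T hs.1.le hs.2.le
    rw [intervalIntegral.integral_mul_const, int_kernel β 0 T hb hT.le, E, sub_zero] at B
    have hp := hgpos T hT
    rw [hg] at hp ⊢
    have h1 : HML β (1 + β) T ≤ 1 := by linarith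
    have h2 : T ^ β / β * HML β 1 T ≤ Real.Gamma β := by nlinarith
    have hTp : 0 < T ^ β := by positivity
    rw [le_div_iff₀ hTp]
    have h3 := mul_le_mul_of_nonneg_left h2 hb.le
    calc _ = β * (T ^ β / β * HML β 1 T) := by field_simp
      _ ≤ _ := h3
  have hlim : Tendsto (fun T : ℝ => ML β (-(T ^ β))) atTop (nhds 0) := by
    refine tendsto_of_tendsto_of_tendsto_of_le_of_le' tendsto_const_nhds
      ((tendsto_rpow_atTop hb).const_div_atTop (β * Real.Gamma β)) ?_ ?_
    · filter_upwards [eventually_gt_atTop 0] with T hT using (hgpos T hT).le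
    · filter_upwards [eventually_gt_atTop 0] with T hT using hbd T hT
  have hI : IntegrableOn (fML β) (Ioi t) := by
    refine integrableOn_Ioi_of_intervalIntegral_norm_bounded (ML β (-(t ^ β))) t
      (b := fun T : ℝ => T) (l := atTop) (fun T => ?_) tendsto_id ?_
    · rcases le_total t T with h | h
      · exact (intervalIntegrable_iff_integrableOn_Ioc_of_le h).1 (hint2 t T ht h)
      · rw [Ioc_eq_empty (by linarith)]; exact integrableOn_empty
    · filter_upwards [eventually_gt_atTop t] with T hT
      have : ∫ u in t..T, ‖fML β u‖ = ∫ u in t..T, fML β u := by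
        rw [intervalIntegral.integral_of_le hT.le, intervalIntegral.integral_of_le hT.le]
        exact setIntegral_congr_fun measurableSet_Ioc fun u hu =>
          Real.norm_of_nonneg (hfpos u (ht.trans_lt hu.1)).le
      rw [this, hF2 t T ht hT.le]
      linarith [hgpos T (ht.trans_lt hT)]
  have l1 := intervalIntegral_tendsto_integral_Ioi t hI tendsto_id
  have l2 : Tendsto (fun T => ∫ u in t..id T, fML β u) atTop (nhds (ML β (-(t ^ β)) - 0)) := by
    refine (hlim.const_sub _).congr' ?_
    filter_upwards [eventually_gt_atTop t] with T hT
    exact (hF2 t T ht hT.le).symm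
  rw [sub_zero] at l2
  exact tendsto_nhds_unique l2 l1
end
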